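/- arXiv:1311.4524 — 4 statements merged into one kernel-verified Lean document; each statement's English description precedes it below -/
import Mathlib

section
/- The root Chacon map T is rigid: there exists a strictly increasing sequence of natural numbers (n_k) such that for every measurable set A ⊆ X, μ(T^{n_k}A Δ A) → 0 as k → ∞. -/
open MeasureTheory Filter Topology
open scoped symmDiff

/-- A Chacon-type rank-one map (cutting into 3, spacer sequence `s` over the middle
column), acting on a probability space `(X, μ)`. -/
structure ChaconMap {X : Type*} [MeasurableSpace X]
    (μ : Measure X) (s : ℕ → ℕ) : Type _ where
  /-- The transformation, an invertible bimeasurable map. -/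
  T : X ≃ᵐ X
  measurePreserving : MeasurePreserving T μ μ
  /-- The tower heights (number of levels is `h j + 1`). -/
  h : ℕ → ℕ
  h_one : h 1 = 1
  h_succ : ∀ j, 1 ≤ j → h (j + 1) = 3 * h j + 2 + s j
  /-- The base of the `j`-th tower. -/
  E : ℕ → Set X
  E1 : ℕ → Set X
  E2 : ℕ → Set X
  E3 : ℕ → Set X
  measE : ∀ j, MeasurableSet (E j)
  measE1 : ∀ j, MeasurableSet (E1 j)
  measE2 : ∀ j, MeasurableSet (E2 j)
  measE3 : ∀ j, MeasurableSet (E3 j)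
  /-- (i) the levels of the `j`-th tower are pairwise disjoint. -/
  tower_disjoint : ∀ j, 1 ≤ j → ∀ i ≤ h j, ∀ i' ≤ h j, i ≠ i' →
    Disjoint ((⇑T)^[i] '' E j) ((⇑T)^[i'] '' E j)
  /-- (ii) the base is cut into three pieces of equal measure. -/
  E_union : ∀ j, 1 ≤ j → E j = E1 j ∪ E2 j ∪ E3 j
  E_disj12 : ∀ j, 1 ≤ j → Disjoint (E1 j) (E2 j)
  E_disj13 : ∀ j, 1 ≤ j → Disjoint (E1 j) (E3 j)
  E_disj23 : ∀ j, 1 ≤ j → Disjoint (E2 j) (E3 j)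
  E_meas12 : ∀ j, 1 ≤ j → μ (E1 j) = μ (E2 j)
  E_meas23 : ∀ j, 1 ≤ j → μ (E2 j) = μ (E3 j)
  E_next : ∀ j, 1 ≤ j → E (j + 1) = E1 j
  /-- (iii) stacking: the top of the first column is sent to the base of the second. -/
  stack1 : ∀ j, 1 ≤ j → μ (((⇑T)^[h j + 1] '' E1 j) ∆ E2 j) = 0
  /-- (iii) stacking: the top spacer over the second column is sent to the third base. -/
  stack2 : ∀ j, 1 ≤ j → μ (((⇑T)^[h j + 1 + s j] '' E2 j) ∆ E3 j) = 0
  /-- (iii) the spacer levels are disjoint from the `j`-th tower. -/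
  spacer_disjoint : ∀ j, 1 ≤ j → ∀ i, 1 ≤ i → i ≤ s j → ∀ i' ≤ h j,
    Disjoint ((⇑T)^[h j + i] '' E2 j) ((⇑T)^[i'] '' E j)
  /-- (iv) the towers fill up the whole space. -/
  tower_full : Tendsto (fun j => μ (⋃ i ∈ Finset.range (h j + 1), (⇑T)^[i] '' E j))
    atTop (𝓝 1)
  /-- (iv) the levels of the towers generate the full σ-algebra mod `μ`. -/
  generates : ∀ A : Set X, MeasurableSet A → ∃ B : Set X,
    MeasurableSet[MeasurableSpace.generateFrom
      {S : Set X | ∃ j, 1 ≤ j ∧ ∃ i ≤ h j, S = (⇑T)^[i] '' E j}] B ∧ μ (A ∆ B) = 0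

namespace RootChacon

variable {X : Type*} [MeasurableSpace X] {μ : Measure X}

/-- forward image by the `n`-th iterate -/
def U (T : X ≃ᵐ X) (n : ℕ) (S : Set X) : Set X := (⇑T)^[n] '' S

lemma U_inj (T : X ≃ᵐ X) (n : ℕ) : Function.Injective ((⇑T)^[n]) := T.injective.iterate n

lemma U_U (T : X ≃ᵐ X) (m n : ℕ) (S : Set X) : U T m (U T n S) = U T (m + n) S := by
  unfold U; rw [Function.iterate_add, Set.image_comp]

lemma U_zero (T : X ≃ᵐ X) (S : Set X) : U T 0 S = S := by simp [U]

lemma U_succ (T : X ≃ᵐ X) (n : ℕ) (S : Set X) : U T (n + 1) S = T '' (U T n S) := by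
  unfold U; rw [Function.iterate_succ', Set.image_comp]

lemma U_diff (T : X ≃ᵐ X) (n : ℕ) (S S' : Set X) : U T n (S \ S') = U T n S \ U T n S' :=
  Set.image_sdiff (U_inj T n) _ _

lemma U_union (T : X ≃ᵐ X) (n : ℕ) (S S' : Set X) : U T n (S ∪ S') = U T n S ∪ U T n S' :=
  Set.image_union _ _ _

lemma U_mono (T : X ≃ᵐ X) (n : ℕ) {S S' : Set X} (h : S ⊆ S') : U T n S ⊆ U T n S' :=
  Set.image_mono h

lemma U_compl (T : X ≃ᵐ X) (n : ℕ) (S : Set X) : U T n Sᶜ = (U T n S)ᶜ :=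
  Set.image_compl_eq (T.bijective.iterate n)

lemma U_meas (T : X ≃ᵐ X) (n : ℕ) {S : Set X} (h : MeasurableSet S) :
    MeasurableSet (U T n S) := by
  induction n with
  | zero => simpa [U_zero] using h
  | succ n ih => rw [U_succ]; exact (T.measurableSet_image).2 ih

lemma U_mu {T : X ≃ᵐ X} (hT : MeasurePreserving T μ μ) (n : ℕ) (S : Set X) :
    μ (U T n S) = μ S := by
  induction n with
  | zero => simp [U_zero]
  | succ n ih =>
    rw [U_succ, ← ih, T.image_eq_preimage_symm]
    exact (hT.symm T).measure_preimage_equiv _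

lemma U_le {T : X ≃ᵐ X} (hT : MeasurePreserving T μ μ) (n : ℕ) {S S' : Set X}
    (h : S ≤ᵐ[μ] S') : U T n S ≤ᵐ[μ] U T n S' := by
  rw [ae_le_set] at h ⊢
  rw [← U_diff, U_mu hT, h]

lemma U_ae {T : X ≃ᵐ X} (hT : MeasurePreserving T μ μ) (n : ℕ) {S S' : Set X}
    (h : S =ᵐ[μ] S') : U T n S =ᵐ[μ] U T n S' :=
  (U_le hT n h.le).antisymm (U_le hT n h.symm.le)

lemma U_mur {T : X ≃ᵐ X} (hT : MeasurePreserving T μ μ) (n : ℕ) (S : Set X) :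
    μ.real (U T n S) = μ.real S := by
  simp [measureReal_def, U_mu hT]

lemma real_mono_ae [IsFiniteMeasure μ] {S S' : Set X} (h : S ≤ᵐ[μ] S') :
    μ.real S ≤ μ.real S' :=
  ENNReal.toReal_mono (measure_ne_top _ _) (measure_mono_ae h)

/-- `A` minus `B` and `B` minus `A` have the same measure when the measures agree -/
lemma diff_swap [IsFiniteMeasure μ] {A B : Set X} (hA : MeasurableSet A) (hB : MeasurableSet B)
    (h : μ.real A = μ.real B) : μ.real (A \ B) = μ.real (B \ A) := by
  have h1 := measureReal_inter_add_sdiff (μ := μ) (s := A) hB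
  have h2 := measureReal_inter_add_sdiff (μ := μ) (s := B) hA
  rw [Set.inter_comm] at h2
  linarith

section
variable [IsProbabilityMeasure μ] {s : ℕ → ℕ} (C : ChaconMap μ s)

lemma stack1' {j : ℕ} (hj : 1 ≤ j) : U C.T (C.h j + 1) (C.E1 j) =ᵐ[μ] C.E2 j :=
  measure_symmDiff_eq_zero_iff.1 (C.stack1 j hj)

lemma stack2' {j : ℕ} (hj : 1 ≤ j) : U C.T (C.h j + 1 + s j) (C.E2 j) =ᵐ[μ] C.E3 j :=
  measure_symmDiff_eq_zero_iff.1 (C.stack2 j hj)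

lemma E2_ae {j : ℕ} (hj : 1 ≤ j) : C.E2 j =ᵐ[μ] U C.T (C.h j + 1) (C.E (j + 1)) := by
  rw [C.E_next j hj]; exact (stack1' C hj).symm

lemma E3_ae {j : ℕ} (hj : 1 ≤ j) :
    C.E3 j =ᵐ[μ] U C.T (2 * (C.h j + 1) + s j) (C.E (j + 1)) := by
  have := (stack2' C hj).symm.trans (U_ae C.measurePreserving _ (E2_ae C hj))
  rw [U_U] at this
  convert this using 2
  ring

lemma E_ae {j : ℕ} (hj : 1 ≤ j) : C.E j =ᵐ[μ] (C.E (j + 1) ∪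
    U C.T (C.h j + 1) (C.E (j + 1)) ∪ U C.T (2 * (C.h j + 1) + s j) (C.E (j + 1)) : Set X) := by
  conv_lhs => rw [C.E_union j hj, ← C.E_next j hj]
  exact ((ae_eq_refl _).union (E2_ae C hj)).union (E3_ae C hj)

lemma mu_next {j : ℕ} (hj : 1 ≤ j) : μ.real (C.E j) = 3 * μ.real (C.E (j + 1)) := by
  rw [C.E_union j hj, C.E_next j hj, measureReal_union _ (C.measE3 j),
    measureReal_union (C.E_disj12 j hj) (C.measE2 j)]
  · have h1 : μ.real (C.E1 j) = μ.real (C.E2 j) := by simp [measureReal_def, C.E_meas12 j hj]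
    have h2 : μ.real (C.E2 j) = μ.real (C.E3 j) := by simp [measureReal_def, C.E_meas23 j hj]
    linarith
  · exact Disjoint.union_left (C.E_disj13 j hj) (C.E_disj23 j hj)

lemma mu_E (j : ℕ) : μ.real (C.E (j + 1)) ≤ (1 / 3 : ℝ) ^ j := by
  induction j with
  | zero => simpa using measureReal_le_one
  | succ j ih =>
    have := mu_next C (j := j + 1) (by omega)
    rw [pow_succ]; linarith

lemma h_ge (j : ℕ) : j + 1 ≤ C.h (j + 1) := by
  induction j with
  | zero => simp [C.h_one]
  | succ j ih =>
    have := C.h_succ (j + 1) (by omega)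
    omega

/-- every tower base is a union of levels of later towers -/
lemma levels {m : ℕ} (hm : 1 ≤ m) (d : ℕ) : ∃ I : Finset ℕ, (∀ i ∈ I, i ≤ C.h (m + d)) ∧
    C.E m =ᵐ[μ] (⋃ i ∈ I, U C.T i (C.E (m + d)) : Set X) := by
  induction d with
  | zero => exact ⟨{0}, by simp, by simpa [U_zero] using EventuallyEq.refl (ae μ) (C.E m)⟩
  | succ d ih =>
    obtain ⟨I, hI, hA⟩ := ih
    have hj : 1 ≤ m + d := by omega
    have hs := C.h_succ (m + d) hj
    set j := m + d with hjd
    refine ⟨I ∪ I.image (fun i => i + (C.h j + 1)) ∪ I.image (fun i => i + (2 * (C.h j + 1) + s j)),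
      ?_, ?_⟩
    · intro i hi
      change i ≤ C.h (j + 1)
      simp only [Finset.mem_union, Finset.mem_image] at hi
      rcases hi with (hi | ⟨a, ha, rfl⟩) | ⟨a, ha, rfl⟩
      · have := hI _ hi; omega
      · have := hI _ ha; omega
      · have := hI _ ha; omega
    · refine hA.trans ?_
      have key : (⋃ i ∈ I, U C.T i (C.E j) : Set X) =ᵐ[μ] (⋃ i ∈ I, U C.T i (C.E (j + 1) ∪
        U C.T (C.h j + 1) (C.E (j + 1)) ∪ U C.T (2 * (C.h j + 1) + s j) (C.E (j + 1))) : Set X) := by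
        refine EventuallyEq.countable_bUnion (Finset.countable_toSet I) ?_
        intro i hi
        exact U_ae C.measurePreserving i (E_ae C hj)
      refine key.trans (Eq.eventuallyEq ?_)
      simp only [U_union, U_U]
      change _ = ⋃ i ∈ _, U C.T i (C.E (j + 1))
      ext x
      simp only [Set.mem_iUnion, Set.mem_union, Finset.mem_union, Finset.mem_image]
      constructor
      · rintro ⟨i, hi, (h | h) | h⟩
        · exact ⟨i, Or.inl (Or.inl hi), h⟩
        · exact ⟨_, Or.inl (Or.inr ⟨i, hi, rfl⟩), h⟩
        · exact ⟨_, Or.inr ⟨i, hi, rfl⟩, h⟩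
      · rintro ⟨i, (hi | ⟨a, ha, rfl⟩) | ⟨a, ha, rfl⟩, h⟩
        · exact ⟨i, hi, Or.inl (Or.inl h)⟩
        · exact ⟨a, ha, Or.inl (Or.inr h)⟩
        · exact ⟨a, ha, Or.inr h⟩

lemma decomp (k r : ℕ) : ∀ j, 1 ≤ j → (∀ t < r, s (j + t) = k) →
    ∃ P Q R : Set X, U C.T (C.h j + 1) (C.E j) ≤ᵐ[μ] (P ∪ Q ∪ R : Set X) ∧
      P ≤ᵐ[μ] C.E j ∧ U C.T k Q ≤ᵐ[μ] C.E j ∧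
      μ.real Q ≤ μ.real (C.E j) / 2 ∧ μ.real R ≤ (1 / 3 : ℝ) ^ r * μ.real (C.E j) := by
  have hT := C.measurePreserving
  induction r with
  | zero =>
    intro j hj _
    refine ⟨∅, ∅, U C.T (C.h j + 1) (C.E j), by simpa using EventuallyLE.refl _ _, ?_, ?_, ?_, ?_⟩
    · exact (Set.empty_subset _).eventuallyLE
    · simp only [U, Set.image_empty]
      exact (Set.empty_subset _).eventuallyLE
    · have := measureReal_nonneg (μ := μ) (s := C.E j)
      rw [measureReal_empty]; linarith
    · simp [U_mur hT]
  | succ r ih =>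
    intro j hj hs
    have hk : s j = k := hs 0 (by omega)
    obtain ⟨P, Q, R, h1, h2, h3, h4, h5⟩ := ih (j + 1) (by omega) (fun t ht => by
      rw [add_assoc, add_comm 1 t]; exact hs (t + 1) (by omega))
    have sub : C.E (j + 1) ⊆ C.E j := by
      rw [C.E_next j hj, C.E_union j hj]; intro x hx; exact Or.inl (Or.inl hx)
    have sub2 : C.E2 j ⊆ C.E j := by
      rw [C.E_union j hj]; intro x hx; exact Or.inl (Or.inr hx)
    have sub3 : C.E3 j ⊆ C.E j := by
      rw [C.E_union j hj]; intro x hx; exact Or.inr hx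
    have hm := mu_next C hj
    refine ⟨C.E2 j ∪ P, U C.T (C.h j + 1) (C.E2 j) ∪ Q, R, ?_, ?_, ?_, ?_, ?_⟩
    · have e3 : U C.T (C.h j + 1) (C.E3 j) ≤ᵐ[μ] (P ∪ Q ∪ R : Set X) := by
        refine (U_ae hT _ (E3_ae C hj)).le.trans ?_
        rw [U_U]
        convert h1 using 2
        rw [C.h_succ j hj]; ring
      rw [C.E_union j hj, U_union, U_union]
      have := (((stack1' C hj).le.union (EventuallyLE.refl _ (U C.T (C.h j + 1) (C.E2 j)))).union e3)
      refine this.trans (HasSubset.Subset.eventuallyLE ?_)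
      intro x hx
      simp only [Set.mem_union] at hx ⊢
      tauto
    · have := (sub2.eventuallyLE (l := ae μ)).union (h2.trans sub.eventuallyLE)
      rwa [Set.union_self] at this
    · rw [U_union, U_U]
      have h6 : U C.T (k + (C.h j + 1)) (C.E2 j) ≤ᵐ[μ] C.E j := by
        have := (stack2' C hj).le.trans sub3.eventuallyLE
        rwa [hk, add_comm] at this
      have := h6.union (h3.trans sub.eventuallyLE)
      rwa [Set.union_self] at this
    · have a1 := measureReal_union_le (μ := μ) (U C.T (C.h j + 1) (C.E2 j)) Q
      rw [U_mur hT] at a1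
      have a2 : μ.real (C.E2 j) = μ.real (C.E (j + 1)) := by
        rw [C.E_next j hj]; simp [measureReal_def, C.E_meas12 j hj]
      linarith
    · rw [hm, pow_succ]; linarith

/-- the displacement of a set -/
noncomputable def dd (μ : Measure X) (T : X ≃ᵐ X) (A : Set X) (n : ℕ) : ℝ :=
  μ.real (U T n A \ A)

lemma dd_nonneg (T : X ≃ᵐ X) (A : Set X) (n : ℕ) : 0 ≤ dd μ T A n := measureReal_nonneg

lemma dd_congr {T : X ≃ᵐ X} (hT : MeasurePreserving T μ μ) {A B : Set X} (h : A =ᵐ[μ] B) (n : ℕ) :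
    dd μ T A n = dd μ T B n := by
  unfold dd
  simp only [measureReal_def]
  rw [measure_congr ((U_ae hT n h).diff h)]

lemma dd_U {T : X ≃ᵐ X} (hT : MeasurePreserving T μ μ) (A : Set X) (i n : ℕ) :
    dd μ T (U T i A) n = dd μ T A n := by
  unfold dd
  rw [U_U, add_comm, ← U_U, ← U_diff, U_mur hT]

/-- the contraction estimate for unions of levels -/
lemma contract {j k r : ℕ} (hj : 1 ≤ j) (hs : ∀ t < r, s (j + t) = k) (I : Finset ℕ)
    (hI : ∀ i ∈ I, i ≤ C.h j) {B : Set X} (hB : B = ⋃ i ∈ I, U C.T i (C.E j)) :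
    dd μ C.T B (C.h j + 1) ≤ dd μ C.T B k / 2 + k * μ.real (C.E j) + (1 / 3 : ℝ) ^ r := by
  classical
  have hT := C.measurePreserving
  obtain ⟨P, Q, R, h1, h2, h3, h4, h5⟩ := decomp C k r j hj hs
  have mE : ∀ i, MeasurableSet (U C.T i (C.E j)) := fun i => U_meas _ _ (C.measE j)
  have mB : MeasurableSet B := by
    rw [hB]; exact Finset.measurableSet_biUnion _ (fun i _ => mE i)
  have hsub : ∀ i ∈ I, U C.T i (C.E j) ⊆ B := by
    intro i hi; rw [hB]; exact Set.subset_biUnion_of_mem (u := fun i => U C.T i (C.E j)) hi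
  have hdis : ∀ i ∈ I, ∀ i' ∈ I, i ≠ i' → Disjoint (U C.T i (C.E j)) (U C.T i' (C.E j)) :=
    fun i hi i' hi' hne => C.tower_disjoint j hj i (hI i hi) i' (hI i' hi') hne
  -- total measure
  have hcard : (I.card : ℝ) * μ.real (C.E j) ≤ 1 := by
    have : μ.real B = ∑ i ∈ I, μ.real (U C.T i (C.E j)) := by
      rw [hB]
      exact measureReal_biUnion_finset (fun i hi i' hi' hne => hdis i hi i' hi' hne)
        (fun i _ => mE i)
    simp only [U_mur hT, Finset.sum_const, nsmul_eq_mul] at this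
    rw [← this]; exact measureReal_le_one
  -- step 1
  have st1 : dd μ C.T B (C.h j + 1) ≤
      ∑ i ∈ I, μ.real (U C.T i (U C.T (C.h j + 1) (C.E j)) \ B) := by
    refine le_trans (measureReal_mono ?_ (measure_ne_top _ _))
      (measureReal_biUnion_finset_le I (fun i => U C.T i (U C.T (C.h j + 1) (C.E j)) \ B))
    rintro x ⟨hx, hxB⟩
    rw [hB] at hx
    obtain ⟨y, hy, rfl⟩ := hx
    simp only [Set.mem_iUnion] at hy ⊢
    obtain ⟨i, hi, hy⟩ := hy
    refine ⟨i, hi, ?_, hxB⟩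
    rw [U_U, add_comm, ← U_U]
    exact ⟨y, hy, rfl⟩
  -- step 2: each term
  have st2 : ∀ i ∈ I, μ.real (U C.T i (U C.T (C.h j + 1) (C.E j)) \ B) ≤
      (if i < k then μ.real (C.E j) else 0) + μ.real (U C.T i (C.E j) \ U C.T k B) / 2
        + (1 / 3 : ℝ) ^ r * μ.real (C.E j) := by
    intro i hi
    have b1 : (U C.T i (U C.T (C.h j + 1) (C.E j)) \ B : Set X) ≤ᵐ[μ]
        (U C.T i Q \ B ∪ U C.T i R : Set X) := by
      have c1 := U_le hT i h1
      rw [U_union, U_union] at c1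
      have c2 : U C.T i P ≤ᵐ[μ] B := (U_le hT i h2).trans (hsub i hi).eventuallyLE
      filter_upwards [c1, c2] with x hx1 hx2 hx
      have := hx1 hx.1
      rcases this with (h | h) | h
      · exact absurd (hx2 h) hx.2
      · exact Or.inl ⟨h, hx.2⟩
      · exact Or.inr h
    have b2 := (real_mono_ae b1).trans (measureReal_union_le _ _)
    rw [U_mur hT] at b2
    have b3 : μ.real (U C.T i Q \ B) ≤
        (if i < k then μ.real (C.E j) else 0) + μ.real (U C.T i (C.E j) \ U C.T k B) / 2 := by
      split_ifs with hik
      · have : μ.real (U C.T i Q \ B) ≤ μ.real (U C.T i Q) := measureReal_mono Set.sdiff_subset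
        rw [U_mur hT] at this
        have := measureReal_nonneg (μ := μ) (s := U C.T i (C.E j) \ U C.T k B)
        have := measureReal_nonneg (μ := μ) (s := C.E j)
        linarith
      · obtain ⟨a, rfl⟩ := Nat.exists_eq_add_of_le (not_lt.1 hik)
        have e1 : μ.real (U C.T (k + a) (C.E j) \ U C.T k B) = μ.real (U C.T a (C.E j) \ B) := by
          rw [← U_U, ← U_diff, U_mur hT]
        rw [e1, zero_add, add_comm k a, ← U_U]
        have hle := U_le hT a h3
        by_cases ha : a ∈ I
        · have : (U C.T a (U C.T k Q) \ B : Set X) ≤ᵐ[μ] (∅ : Set X) := by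
            filter_upwards [hle] with x hx h
            exact absurd (hsub a ha (hx h.1)) h.2
          have := real_mono_ae this
          rw [measureReal_empty] at this
          have := measureReal_nonneg (μ := μ) (s := U C.T a (C.E j) \ B)
          linarith
        · have hd : U C.T a (C.E j) \ B = U C.T a (C.E j) := by
            rw [sdiff_eq_left, hB]
            simp only [Set.disjoint_iUnion_right]
            intro i' hi'
            have hka := hI _ hi
            exact C.tower_disjoint j hj a (by omega) i' (hI i' hi')
              (fun h => ha (h ▸ hi'))
          rw [hd, U_mur hT]
          refine (measureReal_mono Set.sdiff_subset).trans ?_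
          rw [U_mur hT, U_mur hT]; exact h4
    linarith
  have st3 := st1.trans (Finset.sum_le_sum st2)
  rw [Finset.sum_add_distrib, Finset.sum_add_distrib, Finset.sum_const, nsmul_eq_mul,
    ← Finset.sum_div] at st3
  have s1 : ∑ i ∈ I, (if i < k then μ.real (C.E j) else 0) ≤ k * μ.real (C.E j) := by
    rw [← Finset.sum_filter, Finset.sum_const, nsmul_eq_mul]
    refine mul_le_mul_of_nonneg_right ?_ measureReal_nonneg
    have : (I.filter (· < k)) ⊆ Finset.range k := by
      intro i hi; simp at hi; simp [hi.2]
    have := Finset.card_le_card this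
    rw [Finset.card_range] at this
    exact_mod_cast this
  have s2 : ∑ i ∈ I, μ.real (U C.T i (C.E j) \ U C.T k B) ≤ dd μ C.T B k := by
    have e : ∑ i ∈ I, μ.real (U C.T i (C.E j) \ U C.T k B) =
        μ.real (⋃ i ∈ I, (U C.T i (C.E j) \ U C.T k B)) := by
      refine (measureReal_biUnion_finset (fun i hi i' hi' hne => ?_)
        (fun i _ => (mE i).diff (U_meas _ _ mB))).symm
      exact (hdis i hi i' hi' hne).mono Set.sdiff_subset Set.sdiff_subset
    rw [e, dd, diff_swap (U_meas _ _ mB) mB (U_mur hT k B)]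
    refine measureReal_mono ?_
    intro x hx
    simp only [Set.mem_iUnion] at hx
    obtain ⟨i, hi, hx⟩ := hx
    exact ⟨hsub i hi hx.1, hx.2⟩
  have s3 : (I.card : ℝ) * ((1 / 3 : ℝ) ^ r * μ.real (C.E j)) ≤ (1 / 3 : ℝ) ^ r := by
    have : (0 : ℝ) ≤ (1 / 3) ^ r := by positivity
    nlinarith
  linarith

end

lemma contraction_tendsto {a δ : ℕ → ℝ} (ha : ∀ n, 0 ≤ a n) (hb : ∀ n, a n ≤ 1)
    (hδ : Tendsto δ atTop (𝓝 0)) (h : ∀ᶠ n in atTop, a (n + 1) ≤ a n / 2 + δ n) :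
    Tendsto a atTop (𝓝 0) := by
  rw [Metric.tendsto_atTop]
  intro ε hε
  have h2 : ∀ᶠ n in atTop, δ n < ε / 4 := hδ.eventually_lt_const (by positivity)
  obtain ⟨N, hN⟩ := eventually_atTop.1 (h.and h2)
  have key : ∀ i, a (N + i) ≤ (1 / 2 : ℝ) ^ i + ε / 2 := by
    intro i
    induction i with
    | zero => have := hb N; simp; linarith
    | succ i ih =>
      obtain ⟨x, y⟩ := hN (N + i) (by omega)
      rw [← add_assoc, pow_succ]; linarith
  obtain ⟨M, hM⟩ := exists_pow_lt_of_lt_one (show 0 < ε / 2 by positivity)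
    (show (1 / 2 : ℝ) < 1 by norm_num)
  refine ⟨N + M, fun n hn => ?_⟩
  obtain ⟨i, rfl⟩ := Nat.exists_eq_add_of_le (show N ≤ n by omega)
  have h3 : (1 / 2 : ℝ) ^ i ≤ (1 / 2) ^ M :=
    pow_le_pow_of_le_one (by norm_num) (by norm_num) (by omega)
  rw [Real.dist_eq, sub_zero, abs_of_nonneg (ha _)]
  have := key i
  linarith

section
variable [IsProbabilityMeasure μ]

/-- sets with vanishing displacement form a σ-algebra -/
lemma good_generate {T : X ≃ᵐ X} (hT : MeasurePreserving T μ μ) (n : ℕ → ℕ) (G : Set (Set X))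
    (hG : ∀ S ∈ G, MeasurableSet S ∧ Tendsto (fun k => dd μ T S (n k)) atTop (𝓝 0))
    (S : Set X) (hS : MeasurableSet[MeasurableSpace.generateFrom G] S) :
    MeasurableSet S ∧ Tendsto (fun k => dd μ T S (n k)) atTop (𝓝 0) := by
  induction S, hS using MeasurableSpace.generateFrom_induction with
  | hC S hS _ => exact hG S hS
  | empty => exact ⟨MeasurableSet.empty, by simp [dd, U]⟩
  | compl S _ ih =>
    refine ⟨ih.1.compl, ih.2.congr fun k => ?_⟩
    unfold dd
    rw [U_compl, compl_sdiff_compl, diff_swap (U_meas _ _ ih.1) ih.1 (U_mur hT _ _)]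
  | iUnion f _ ih =>
    have mf : ∀ i, MeasurableSet (f i) := fun i => (ih i).1
    have mV : MeasurableSet (⋃ i, f i) := MeasurableSet.iUnion mf
    refine ⟨mV, ?_⟩
    have tail : Tendsto (fun N => μ.real ((⋃ i, f i) \ Set.accumulate f N)) atTop (𝓝 0) := by
      have t1 : Tendsto (fun N => μ.real (Set.accumulate f N)) atTop (𝓝 (μ.real (⋃ i, f i))) :=
        (ENNReal.tendsto_toReal (measure_ne_top _ _)).comp tendsto_measure_iUnion_accumulate
      have t2 := t1.const_sub (μ.real (⋃ i, f i))
      rw [sub_self] at t2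
      refine t2.congr fun N => ?_
      rw [measureReal_sdiff (Set.accumulate_subset_iUnion N)
        (MeasurableSet.biUnion (Set.to_countable _) (fun i _ => mf i))]
    have bd : ∀ N m, dd μ T (⋃ i, f i) m ≤
        ∑ i ∈ Finset.range (N + 1), dd μ T (f i) m + μ.real ((⋃ i, f i) \ Set.accumulate f N) := by
      intro N m
      have : U T m (⋃ i, f i) \ (⋃ i, f i) ⊆ (⋃ i ∈ Finset.range (N + 1), (U T m (f i) \ f i)) ∪
          U T m ((⋃ i, f i) \ Set.accumulate f N) := by
        rintro x ⟨⟨y, hy, rfl⟩, hx⟩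
        by_cases hyN : y ∈ Set.accumulate f N
        · left
          obtain ⟨i, hi, hyi⟩ := Set.mem_accumulate.1 hyN
          simp only [Set.mem_iUnion]
          refine ⟨i, Finset.mem_range.2 (by omega), ⟨y, hyi, rfl⟩, fun hc => hx ?_⟩
          exact Set.mem_iUnion.2 ⟨i, hc⟩
        · right
          exact ⟨y, ⟨hy, hyN⟩, rfl⟩
      refine (measureReal_mono this).trans ((measureReal_union_le _ _).trans ?_)
      rw [U_mur hT]
      exact add_le_add (measureReal_biUnion_finset_le _ _) le_rfl
    rw [Metric.tendsto_atTop]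
    intro ε hε
    obtain ⟨N, hN⟩ := (tail.eventually_lt_const (show (0 : ℝ) < ε / 2 by positivity)).exists
    have ts : Tendsto (fun k => ∑ i ∈ Finset.range (N + 1), dd μ T (f i) (n k)) atTop (𝓝 0) := by
      have := tendsto_finsetSum (Finset.range (N + 1)) (fun i _ => (ih i).2)
      simpa using this
    obtain ⟨M, hM⟩ := eventually_atTop.1
      (ts.eventually_lt_const (show (0 : ℝ) < ε / 2 by positivity))
    refine ⟨M, fun k hk => ?_⟩
    rw [Real.dist_eq, sub_zero, abs_of_nonneg (dd_nonneg _ _ _)]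
    have := bd N (n k)
    have := hM k hk
    linarith

end

end RootChacon

open RootChacon in
/-- the root Chacon map (spacer sequence `⌊√j⌋`) is rigid. -/
theorem rootChacon_rigid
    {X : Type*} [MeasurableSpace X] (μ : Measure X) [IsProbabilityMeasure μ]
    (C : ChaconMap μ (fun j => Nat.sqrt j)) :
    ∃ n : ℕ → ℕ, StrictMono n ∧
      ∀ A : Set X, MeasurableSet A →
        Tendsto (fun k => μ (((⇑C.T)^[n k] '' A) ∆ A)) atTop (𝓝 0) := by
  have hT := C.measurePreserving
  let f : ℕ → ℕ := fun k => C.h (k * k) + 1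
  let n : ℕ → ℕ := fun i => f^[i] 1
  have n_succ : ∀ i, n (i + 1) = C.h (n i * n i) + 1 := fun i => Function.iterate_succ_apply' f i 1
  have hf : ∀ k, 1 ≤ k → k < C.h (k * k) + 1 := by
    intro k hk
    have h1 : k ≤ k * k := Nat.le_mul_self k
    obtain ⟨q, hq⟩ := Nat.exists_eq_add_of_le (show 1 ≤ k * k by omega)
    have := h_ge C q
    rw [hq, add_comm 1 q]; omega
  have n_pos : ∀ i, 1 ≤ n i := by
    intro i
    cases i with
    | zero => exact le_rfl
    | succ i => rw [n_succ]; omega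
  have nmono : StrictMono n := strictMono_nat_of_lt_succ fun i => by
    rw [n_succ]; exact hf _ (n_pos i)
  refine ⟨n, nmono, ?_⟩
  have ntop : Tendsto n atTop atTop := nmono.tendsto_atTop
  -- bases
  have base : ∀ m, 1 ≤ m → Tendsto (fun i => dd μ C.T (C.E m) (n i)) atTop (𝓝 0) := by
    intro m hm
    let δ : ℕ → ℝ := fun k => 3 * (k * (1 / 3 : ℝ) ^ k) + (1 / 3 : ℝ) ^ k
    have hδ : Tendsto δ atTop (𝓝 0) := by
      have t1 := tendsto_self_mul_const_pow_of_lt_one (r := (1 / 3 : ℝ)) (by norm_num) (by norm_num)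
      have t2 := tendsto_pow_atTop_nhds_zero_of_lt_one (r := (1 / 3 : ℝ)) (by norm_num) (by norm_num)
      simpa [δ] using (t1.const_mul 3).add t2
    refine contraction_tendsto (δ := fun i => δ (n i)) (fun _ => dd_nonneg _ _ _)
      (fun _ => measureReal_le_one) (hδ.comp ntop) ?_
    filter_upwards [ntop.eventually_ge_atTop m] with i hi
    rw [n_succ]
    set k := n i with hk
    have hk1 : 1 ≤ k := n_pos i
    have hkk : k ≤ k * k := Nat.le_mul_self k
    obtain ⟨d, hd⟩ := Nat.exists_eq_add_of_le (show m ≤ k * k by omega)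
    obtain ⟨I, hI, hA⟩ := levels C hm d
    rw [← hd] at hI hA
    have hs : ∀ t < k, (fun j => Nat.sqrt j) (k * k + t) = k := by
      intro t ht
      exact Nat.sqrt_add_eq k (by omega)
    have := contract C (by omega) hs I hI rfl
    rw [← dd_congr hT hA, ← dd_congr hT hA] at this
    have hE : μ.real (C.E (k * k)) ≤ 3 * (1 / 3 : ℝ) ^ k := by
      obtain ⟨q, hq⟩ := Nat.exists_eq_add_of_le (show 1 ≤ k * k by omega)
      rw [hq, add_comm 1 q]
      refine (mu_E C q).trans ?_
      have : (1 / 3 : ℝ) ^ (q + 1) ≤ (1 / 3) ^ k :=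
        pow_le_pow_of_le_one (by norm_num) (by norm_num) (by omega)
      rw [pow_succ] at this
      linarith
    have hE2 := mul_le_mul_of_nonneg_left hE (show (0 : ℝ) ≤ k by positivity)
    simp only [δ]
    linarith
  intro A hA
  obtain ⟨B, hB, hAB⟩ := C.generates A hA
  have hAB' : A =ᵐ[μ] B := measure_symmDiff_eq_zero_iff.1 hAB
  have good := good_generate hT n _ (by
    rintro S ⟨j, hj, i, hi, rfl⟩
    refine ⟨U_meas C.T i (C.measE j), (base j hj).congr fun k => ?_⟩
    exact (dd_U hT (C.E j) i (n k)).symm) B hB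
  have goodA : Tendsto (fun k => dd μ C.T A (n k)) atTop (𝓝 0) :=
    good.2.congr fun k => (dd_congr hT hAB' (n k)).symm
  have g2 := (ENNReal.tendsto_ofReal (goodA.const_mul 2))
  rw [mul_zero, ENNReal.ofReal_zero] at g2
  refine g2.congr fun k => ?_
  change _ = μ (U C.T (n k) A ∆ A)
  have e : μ.real (U C.T (n k) A ∆ A) = 2 * dd μ C.T A (n k) := by
    rw [Set.symmDiff_def, measureReal_union disjoint_sdiff_sdiff (hA.diff (U_meas _ _ hA)),
      ← diff_swap (U_meas _ _ hA) hA (U_mur hT _ _), two_mul]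
    rfl
  rw [← e]
  exact ofReal_measureReal (measure_ne_top μ _)
end

section
/- Let T be the root Chacon map. For every natural number p there exists a sequence q(k) → ∞ such that T^{q(k)} converges weakly to ½I + ½T^p, i.e. for all measurable sets A, B ⊆ X, μ(T^{q(k)}A ∩ B) → ½μ(A ∩ B) + ½μ(T^pA ∩ B) as k → ∞. -/
open MeasureTheory Filter Topology
open scoped symmDiff

namespace ChaconAux

set_option linter.unusedSectionVars false

section basic
variable {X : Type*} [MeasurableSpace X] {μ : Measure X}

lemma img_img (f : X → X) (a b : ℕ) (A : Set X) : f^[a] '' (f^[b] '' A) = f^[a + b] '' A := by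
  rw [Function.iterate_add, Set.image_comp]

lemma img_meas (T : X ≃ᵐ X) (k : ℕ) {A : Set X} (hA : MeasurableSet A) :
    MeasurableSet ((⇑T)^[k] '' A) := by
  induction k with
  | zero => simpa using hA
  | succ k ih =>
    rw [Function.iterate_succ', Set.image_comp]
    exact T.measurableSet_image.2 ih

lemma img_measure (T : X ≃ᵐ X) (hT : MeasurePreserving T μ μ) (k : ℕ) (A : Set X) :
    μ ((⇑T)^[k] '' A) = μ A := by
  induction k with
  | zero => simp
  | succ k ih =>
    rw [Function.iterate_succ', Set.image_comp, ← hT.measure_preimage_equiv,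
      Set.preimage_image_eq _ T.injective, ih]

lemma img_real (T : X ≃ᵐ X) (hT : MeasurePreserving T μ μ) (k : ℕ) (A : Set X) :
    μ.real ((⇑T)^[k] '' A) = μ.real A := by
  simp [Measure.real, img_measure T hT]

lemma img_inter (T : X ≃ᵐ X) (k : ℕ) (A B : Set X) :
    (⇑T)^[k] '' (A ∩ B) = (⇑T)^[k] '' A ∩ (⇑T)^[k] '' B :=
  Set.image_inter (T.injective.iterate k)

lemma img_diff (T : X ≃ᵐ X) (k : ℕ) (A B : Set X) :
    (⇑T)^[k] '' (A \ B) = (⇑T)^[k] '' A \ (⇑T)^[k] '' B :=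
  Set.image_sdiff (T.injective.iterate k) _ _

lemma img_symmDiff (T : X ≃ᵐ X) (k : ℕ) (A B : Set X) :
    (⇑T)^[k] '' (A ∆ B) = ((⇑T)^[k] '' A) ∆ ((⇑T)^[k] '' B) :=
  Set.image_symmDiff (T.injective.iterate k) _ _

lemma ae_le_img (T : X ≃ᵐ X) (hT : MeasurePreserving T μ μ) (k : ℕ) {A B : Set X}
    (h : A ≤ᵐ[μ] B) : ((⇑T)^[k] '' A : Set X) ≤ᵐ[μ] ((⇑T)^[k] '' B : Set X) := by
  rw [ae_le_set] at h ⊢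
  rw [← img_diff, img_measure T hT, h]

lemma ae_eq_img (T : X ≃ᵐ X) (hT : MeasurePreserving T μ μ) (k : ℕ) {A B : Set X}
    (h : A =ᵐ[μ] B) : ((⇑T)^[k] '' A : Set X) =ᵐ[μ] ((⇑T)^[k] '' B : Set X) := by
  rw [← measure_symmDiff_eq_zero_iff] at h ⊢
  rw [← img_symmDiff, img_measure T hT, h]

/-- comparing intersections -/
lemma inter_le [IsProbabilityMeasure μ] (A A' B B' : Set X) :
    μ.real (A ∩ B) ≤ μ.real (A' ∩ B') + μ.real (A ∆ A') + μ.real (B ∆ B') := by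
  have : A ∩ B ⊆ ((A' ∩ B') ∪ (A ∆ A')) ∪ (B ∆ B') := by
    intro x ⟨h1, h2⟩
    by_cases h3 : x ∈ A' <;> by_cases h4 : x ∈ B' <;> simp [Set.mem_symmDiff, *]
  refine (measureReal_mono this).trans ((measureReal_union_le _ _).trans ?_)
  gcongr
  exact measureReal_union_le _ _

end basic

lemma real_seq {x : ℕ → ℝ} (hb : ∀ i, |x i| ≤ 1)
    (h : Tendsto (fun i => x (i+1) - x i / 2) atTop (𝓝 0)) : Tendsto x atTop (𝓝 0) := by
  rw [Metric.tendsto_atTop] at h ⊢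
  intro ε hε
  obtain ⟨N, hN⟩ := h (ε/4) (by positivity)
  have key : ∀ k, |x (N + k)| ≤ (1/2)^k + ε/2 := by
    intro k
    induction k with
    | zero => have := hb N; simp only [add_zero, pow_zero]; linarith
    | succ k ih =>
      have := hN (N+k) (by omega)
      rw [Real.dist_eq, sub_zero, abs_lt] at this
      rw [abs_le] at ih ⊢
      rw [← add_assoc, pow_succ]
      constructor <;> linarith
  obtain ⟨K, hK⟩ := exists_pow_lt_of_lt_one (show 0 < ε/2 by positivity) (show (1/2:ℝ) < 1 by norm_num)
  refine ⟨N + K, fun n hn => ?_⟩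
  obtain ⟨d, rfl⟩ := Nat.exists_eq_add_of_le hn
  have h1 := key (K + d)
  have h2 : (1/2:ℝ)^(K+d) ≤ (1/2)^K := pow_le_pow_of_le_one (by norm_num) (by norm_num) (by omega)
  rw [Real.dist_eq, sub_zero]
  rw [← add_assoc] at h1
  linarith

section chacon
variable {X : Type*} [MeasurableSpace X] {μ : Measure X} {s : ℕ → ℕ} (C : ChaconMap μ s)

/-- union of levels -/
def lv (D : Set X) (F : Finset ℕ) : Set X := ⋃ i ∈ F, (⇑C.T)^[i] '' D

lemma mem_lv {D : Set X} {F : Finset ℕ} {x : X} : x ∈ lv C D F ↔ ∃ i ∈ F, x ∈ (⇑C.T)^[i] '' D := by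
  simp only [lv, Set.mem_iUnion, exists_prop]

lemma lv_meas {D : Set X} (hD : MeasurableSet D) (F : Finset ℕ) : MeasurableSet (lv C D F) :=
  Finset.measurableSet_biUnion _ fun _ _ => img_meas _ _ hD

lemma H_succ (j : ℕ) (hj : 1 ≤ j) : C.h (j+1) + 1 = (C.h j + 1) + (C.h j + 1 + s j) + (C.h j + 1) := by
  rw [C.h_succ j hj]; ring

lemma E1_eq2 (j : ℕ) (hj : 1 ≤ j) :
    ((⇑C.T)^[C.h j + 1] '' C.E (j+1) : Set X) =ᵐ[μ] C.E2 j := by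
  rw [C.E_next j hj]; exact measure_symmDiff_eq_zero_iff.1 (C.stack1 j hj)

lemma E2_eq3 (j : ℕ) (hj : 1 ≤ j) :
    ((⇑C.T)^[C.h j + 1 + s j] '' C.E2 j : Set X) =ᵐ[μ] C.E3 j :=
  measure_symmDiff_eq_zero_iff.1 (C.stack2 j hj)

lemma E1_eq3 (j : ℕ) (hj : 1 ≤ j) :
    ((⇑C.T)^[(C.h j + 1 + s j) + (C.h j + 1)] '' C.E (j+1) : Set X) =ᵐ[μ] C.E3 j := by
  rw [← img_img]
  exact (ae_eq_img _ C.measurePreserving _ (E1_eq2 C j hj)).trans (E2_eq3 C j hj)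

lemma E2_sub (j : ℕ) (hj : 1 ≤ j) : C.E2 j ⊆ C.E j := by
  rw [C.E_union j hj]; intro x hx; simp [hx]
lemma E3_sub (j : ℕ) (hj : 1 ≤ j) : C.E3 j ⊆ C.E j := by
  rw [C.E_union j hj]; intro x hx; simp [hx]
lemma E_anti (j : ℕ) (hj : 1 ≤ j) : C.E (j+1) ⊆ C.E j := by
  rw [C.E_union j hj, C.E_next j hj]; intro x hx; simp [hx]
lemma E_anti' (j : ℕ) (hj : 1 ≤ j) (i : ℕ) : C.E (j+i) ⊆ C.E j := by
  induction i with
  | zero => exact subset_rfl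
  | succ i ih => exact (E_anti C (j+i) (by omega)).trans ih

/-- top columns -/
lemma top_sub (j : ℕ) (hj : 1 ≤ j) (i : ℕ) :
    ((⇑C.T)^[C.h (j+i) + 1] '' C.E (j+i) : Set X) ≤ᵐ[μ] ((⇑C.T)^[C.h j + 1] '' C.E j : Set X) := by
  induction i with
  | zero => exact Filter.EventuallyLE.refl _ _
  | succ i ih =>
    refine Filter.EventuallyLE.trans ?_ ih
    rw [← add_assoc, H_succ C (j+i) (by omega), add_assoc _ _ (C.h (j+i) + 1), ← img_img]
    refine ae_le_img _ C.measurePreserving _ ?_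
    exact (E1_eq3 C (j+i) (by omega)).le.trans
      (LE.le.eventuallyLE (E3_sub C (j+i) (by omega)))

lemma E2_le (j : ℕ) (hj : 1 ≤ j) (i : ℕ) :
    C.E2 (j+i) ≤ᵐ[μ] (C.E j ∩ (⇑C.T)^[C.h j + 1] '' C.E j : Set X) := by
  have h1 : C.E2 (j+i) ≤ᵐ[μ] C.E j :=
    LE.le.eventuallyLE ((E2_sub C (j+i) (by omega)).trans (E_anti' C j hj i))
  have h2 : C.E2 (j+i) ≤ᵐ[μ] ((⇑C.T)^[C.h j + 1] '' C.E j : Set X) := by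
    refine (E1_eq2 C (j+i) (by omega)).symm.le.trans ?_
    refine Filter.EventuallyLE.trans ?_ (top_sub C j hj i)
    exact LE.le.eventuallyLE (Set.image_mono (E_anti C (j+i) (by omega)))
  filter_upwards [h1, h2] with x hx1 hx2 hx using ⟨hx1 hx, hx2 hx⟩

lemma E3_le (j : ℕ) (hj : 1 ≤ j) (i : ℕ) :
    C.E3 (j+i) ≤ᵐ[μ] (C.E j ∩ (⇑C.T)^[C.h j + 1 + s (j+i)] '' C.E j : Set X) := by
  have h1 : C.E3 (j+i) ≤ᵐ[μ] C.E j :=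
    LE.le.eventuallyLE ((E3_sub C (j+i) (by omega)).trans (E_anti' C j hj i))
  have h2 : C.E3 (j+i) ≤ᵐ[μ] ((⇑C.T)^[C.h j + 1 + s (j+i)] '' C.E j : Set X) := by
    refine (E2_eq3 C (j+i) (by omega)).symm.le.trans ?_
    rw [add_comm (C.h j + 1), add_comm (C.h (j+i) + 1), ← img_img _ (s (j+i)) (C.h (j+i) + 1),
      ← img_img _ (s (j+i)) (C.h j + 1)]
    refine ae_le_img _ C.measurePreserving _ ?_
    refine Filter.EventuallyLE.trans ?_ (top_sub C j hj i)
    exact LE.le.eventuallyLE (Set.image_mono (E2_sub C (j+i) (by omega)))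
  filter_upwards [h1, h2] with x hx1 hx2 hx using ⟨hx1 hx, hx2 hx⟩

variable [IsProbabilityMeasure μ]

lemma E_real (j : ℕ) (hj : 1 ≤ j) : μ.real (C.E2 j) = μ.real (C.E (j+1)) ∧
    μ.real (C.E3 j) = μ.real (C.E (j+1)) ∧ μ.real (C.E j) = 3 * μ.real (C.E (j+1)) := by
  have h2 : μ.real (C.E2 j) = μ.real (C.E (j+1)) := by
    rw [C.E_next j hj]; simp [Measure.real, C.E_meas12 j hj]
  have h3 : μ.real (C.E3 j) = μ.real (C.E (j+1)) := by
    rw [← h2]; simp [Measure.real, C.E_meas23 j hj]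
  refine ⟨h2, h3, ?_⟩
  rw [C.E_union j hj, measureReal_union _ (C.measE3 j), measureReal_union (C.E_disj12 j hj) (C.measE2 j),
    h2, h3, C.E_next j hj]
  · ring
  · exact Disjoint.union_left (C.E_disj13 j hj) (C.E_disj23 j hj)

lemma E_pow (j : ℕ) (hj : 1 ≤ j) (i : ℕ) : μ.real (C.E (j+i)) = (1/3)^i * μ.real (C.E j) := by
  induction i with
  | zero => simp
  | succ i ih =>
    have := (E_real C (j+i) (by omega)).2.2
    rw [ih] at this
    rw [pow_succ, ← add_assoc]; linarith

lemma half_mass (j : ℕ) (hj : 1 ≤ j) (L : ℕ) (D : Set X) (K : ℕ → Set X)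
    (hK : ∀ i < L, K i ⊆ C.E (j+i) \ C.E (j+i+1)) (hKm : ∀ i, MeasurableSet (K i))
    (hKD : ∀ i < L, K i ≤ᵐ[μ] D) (hKE : ∀ i < L, μ.real (K i) = μ.real (C.E (j+i+1))) :
    (1/2) * (1 - (1/3)^L) * μ.real (C.E j) ≤ μ.real D := by
  have key : ∀ l ≤ L, (1/2) * (1 - (1/3)^l) * μ.real (C.E j) ≤ μ.real (D \ C.E (j+l)) := by
    intro l
    induction l with
    | zero => simp
    | succ l ih =>
      intro hl
      have h1 := ih (by omega)
      have h2 : ((D \ C.E (j+l)) ∪ K l : Set X) ≤ᵐ[μ] (D \ C.E (j+(l+1)) : Set X) := by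
        filter_upwards [hKD l (by omega)] with x hx hx'
        rcases hx' with hx' | hx'
        · exact ⟨hx'.1, fun h => hx'.2 (E_anti C (j+l) (by omega) h)⟩
        · exact ⟨hx hx', (hK l (by omega) hx').2⟩
      have h3 : μ.real ((D \ C.E (j+l)) ∪ K l) ≤ μ.real (D \ C.E (j+(l+1))) :=
        ENNReal.toReal_mono (measure_ne_top _ _) (measure_mono_ae h2)
      rw [measureReal_union _ (hKm l), hKE l (by omega), add_assoc, E_pow C j hj] at h3
      · rw [pow_succ] at h3 ⊢
        linarith
      · rw [Set.disjoint_left]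
        exact fun x hx hx' => hx.2 (hK l (by omega) hx').1
  exact (key L le_rfl).trans (measureReal_mono Set.sdiff_subset)

lemma E2_half (j : ℕ) (hj : 1 ≤ j) (L : ℕ) : (1/2) * (1 - (1/3)^L) * μ.real (C.E j) ≤
    μ.real (C.E j ∩ (⇑C.T)^[C.h j + 1] '' C.E j : Set X) := by
  refine half_mass C j hj L _ (fun i => C.E2 (j+i))
    (fun i _ x hx => ⟨E2_sub C _ (by omega) hx, ?_⟩) (fun i => C.measE2 _) (fun i _ => E2_le C j hj i)
    (fun i _ => (E_real C (j+i) (by omega)).1)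
  rw [C.E_next _ (by omega)]
  exact fun h => Set.disjoint_left.1 (C.E_disj12 (j+i) (by omega)) h hx

lemma E3_half (j : ℕ) (hj : 1 ≤ j) (L : ℕ) (t : ℕ) (ht : ∀ i < L, s (j+i) = t) :
    (1/2) * (1 - (1/3)^L) * μ.real (C.E j) ≤
    μ.real (C.E j ∩ (⇑C.T)^[C.h j + 1 + t] '' C.E j : Set X) := by
  refine half_mass C j hj L _ (fun i => C.E3 (j+i))
    (fun i _ x hx => ⟨E3_sub C _ (by omega) hx, ?_⟩) (fun i => C.measE3 _)
    (fun i hi => ht i hi ▸ E3_le C j hj i)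
    (fun i _ => (E_real C (j+i) (by omega)).2.1)
  rw [C.E_next _ (by omega)]
  exact fun h => Set.disjoint_left.1 (C.E_disj13 (j+i) (by omega)) h hx


lemma lv_real (j : ℕ) (hj : 1 ≤ j) {D : Set X} (hD : MeasurableSet D) (hDE : D ⊆ C.E j)
    {F : Finset ℕ} (hF : F ⊆ Finset.range (C.h j + 1)) :
    μ.real (lv C D F) = F.card * μ.real D := by
  rw [lv, measureReal_biUnion_finset]
  · simp [img_real C.T C.measurePreserving]
  · intro a ha b hb hab
    have h1 := Finset.mem_range.1 (hF ha)
    have h2 := Finset.mem_range.1 (hF hb)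
    exact (C.tower_disjoint j hj a (by omega) b (by omega) hab).mono
      (Set.image_mono hDE) (Set.image_mono hDE)
  · exact fun _ _ => img_meas _ _ hD

lemma lower (j : ℕ) (hj : 1 ≤ j) (L t : ℕ) (ht : ∀ i < L, s (j+i) = t) (ht1 : 1 ≤ t)
    (hth : t ≤ C.h j) {F G : Finset ℕ} (hF : F ⊆ Finset.range (C.h j + 1))
    (hG : G ⊆ Finset.range (C.h j + 1)) :
    (1/2) * μ.real (lv C (C.E j) F ∩ lv C (C.E j) G)
      + (1/2) * μ.real (lv C (C.E j) F ∩ (⇑C.T)^[t] '' lv C (C.E j) G)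
      ≤ μ.real ((⇑C.T)^[C.h j + 1] '' lv C (C.E j) F ∩ lv C (C.E j) G)
        + (1/3)^L + t * μ.real (C.E j) := by
  classical
  set E := C.E j with hE
  set H := C.h j + 1 with hH
  set D0 : Set X := E ∩ (⇑C.T)^[H] '' E with hD0
  set D1 : Set X := E ∩ (⇑C.T)^[H + t] '' E with hD1
  have mE : MeasurableSet E := C.measE j
  have mD0 : MeasurableSet D0 := mE.inter (img_meas _ _ mE)
  have mD1 : MeasurableSet D1 := mE.inter (img_meas _ _ mE)
  have b0 := E2_half C j hj L
  have b1 := E3_half C j hj L t ht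
  rw [← hE, ← hH, ← hD0] at b0
  rw [← hE, ← hH, ← hD1] at b1
  set N0 := F ∩ G with hN0
  set N1 := G.filter (fun l => l + t ∈ F) with hN1
  have hN0s : N0 ⊆ Finset.range (C.h j + 1) := Finset.inter_subset_left.trans hF
  have hN1s : N1 ⊆ Finset.range (C.h j + 1) := (Finset.filter_subset _ _).trans hG
  have hdis : ∀ i i' x, i ∈ Finset.range (C.h j + 1) → i' ∈ Finset.range (C.h j + 1) →
      x ∈ (⇑C.T)^[i] '' E → x ∈ (⇑C.T)^[i'] '' E → i = i' := by
    intro i i' x hi hi' hx hx'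
    by_contra hne
    rw [Finset.mem_range] at hi hi'
    exact Set.disjoint_left.1 (C.tower_disjoint j hj i (by omega) i' (by omega) hne) hx hx'
  have hD01 : ∀ x, x ∈ D0 → x ∈ D1 → False := by
    intro x h0 h1
    have h0 := h0.2
    have h1 := h1.2
    rw [← img_img] at h1
    have h2 : Disjoint E ((⇑C.T)^[t] '' E) := by
      simpa using C.tower_disjoint j hj 0 (by omega) t hth (by omega)
    have h3 := (Set.disjoint_image_iff (C.T.injective.iterate H)).2 h2
    exact Set.disjoint_left.1 h3 h0 h1
  -- lower bound
  have hsub : lv C D0 N0 ∪ lv C D1 N1 ⊆ (⇑C.T)^[H] '' lv C E F ∩ lv C E G := by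
    rintro x (hx | hx) <;> rw [mem_lv] at hx <;> obtain ⟨l, hl, hx⟩ := hx
    · rw [hN0, Finset.mem_inter] at hl
      refine ⟨?_, (mem_lv C).2 ⟨l, hl.2, Set.image_mono Set.inter_subset_left hx⟩⟩
      have h1 : x ∈ (⇑C.T)^[l] '' ((⇑C.T)^[H] '' E) := Set.image_mono Set.inter_subset_right hx
      rw [img_img, add_comm, ← img_img] at h1
      exact Set.image_mono (fun y hy => (mem_lv C).2 ⟨l, hl.1, hy⟩) h1
    · rw [hN1, Finset.mem_filter] at hl
      refine ⟨?_, (mem_lv C).2 ⟨l, hl.1, Set.image_mono Set.inter_subset_left hx⟩⟩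
      have h1 : x ∈ (⇑C.T)^[l] '' ((⇑C.T)^[H + t] '' E) := Set.image_mono Set.inter_subset_right hx
      rw [img_img, show l + (H + t) = H + (l + t) by ring, ← img_img] at h1
      exact Set.image_mono (fun y hy => (mem_lv C).2 ⟨l + t, hl.2, hy⟩) h1
  have hdisj : Disjoint (lv C D0 N0) (lv C D1 N1) := by
    rw [Set.disjoint_left]
    intro x hx hx'
    rw [mem_lv] at hx hx'
    obtain ⟨l, hl, hx⟩ := hx
    obtain ⟨l', hl', hx'⟩ := hx'
    have hll := hdis l l' x (hN0s hl) (hN1s hl') (Set.image_mono Set.inter_subset_left hx)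
      (Set.image_mono Set.inter_subset_left hx')
    subst hll
    obtain ⟨y, hy, rfl⟩ := hx
    obtain ⟨z, hz, hzy⟩ := hx'
    have := C.T.injective.iterate l hzy
    subst this
    exact hD01 _ hy hz
  have h1 := measureReal_mono (μ := μ) hsub
  rw [measureReal_union hdisj (lv_meas C mD1 _), lv_real C j hj mD0 Set.inter_subset_left hN0s,
    lv_real C j hj mD1 Set.inter_subset_left hN1s] at h1
  -- upper bounds
  have u0 : μ.real (lv C E F ∩ lv C E G) ≤ N0.card * μ.real E := by
    rw [← lv_real C j hj mE subset_rfl hN0s]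
    refine measureReal_mono ?_
    rintro x ⟨hx, hx'⟩
    rw [mem_lv] at hx hx'
    obtain ⟨l, hl, hx⟩ := hx
    obtain ⟨l', hl', hx'⟩ := hx'
    have hll := hdis l l' x (hF hl) (hG hl') hx hx'
    subst hll
    exact (mem_lv C).2 ⟨l, Finset.mem_inter.2 ⟨hl, hl'⟩, hx⟩
  have u1 : μ.real (lv C E F ∩ (⇑C.T)^[t] '' lv C E G) ≤ N1.card * μ.real E + t * μ.real E := by
    have hs : lv C E F ∩ (⇑C.T)^[t] '' lv C E G ⊆
        (⇑C.T)^[t] '' lv C E N1 ∪ lv C E (Finset.Ico H (H + t)) := by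
      rintro x ⟨hx, ⟨y, hy, rfl⟩⟩
      rw [mem_lv] at hx hy
      obtain ⟨l, hl, hx⟩ := hx
      obtain ⟨l', hl', hy⟩ := hy
      have hy' : (⇑C.T)^[t] y ∈ (⇑C.T)^[l' + t] '' E := by
        rw [add_comm, ← img_img]; exact Set.mem_image_of_mem _ hy
      have hl'r := Finset.mem_range.1 (hG hl')
      by_cases hc : l' + t < H
      · left
        have hll := hdis l (l' + t) _ (hF hl) (Finset.mem_range.2 hc) hx hy'
        subst hll
        exact Set.mem_image_of_mem _ ((mem_lv C).2 ⟨l', Finset.mem_filter.2 ⟨hl', hl⟩, hy⟩)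
      · right
        exact (mem_lv C).2 ⟨l' + t, Finset.mem_Ico.2 ⟨by omega, by omega⟩, hy'⟩
    refine (measureReal_mono hs).trans ((measureReal_union_le _ _).trans ?_)
    rw [img_real C.T C.measurePreserving, lv_real C j hj mE subset_rfl hN1s]
    gcongr
    refine (measureReal_biUnion_finset_le _ _).trans ?_
    simp [img_real C.T C.measurePreserving]
  have v0 : N0.card * μ.real E ≤ 1 := by
    rw [← lv_real C j hj mE subset_rfl hN0s]; exact measureReal_le_one
  have v1 : N1.card * μ.real E ≤ 1 := by
    rw [← lv_real C j hj mE subset_rfl hN1s]; exact measureReal_le_one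
  have w0 := mul_le_mul_of_nonneg_left b0 (Nat.cast_nonneg (α := ℝ) N0.card)
  have w1 := mul_le_mul_of_nonneg_left b1 (Nat.cast_nonneg (α := ℝ) N1.card)
  have hp : (0:ℝ) ≤ (1/3)^L := by positivity
  have x0 := mul_le_mul_of_nonneg_left v0 hp
  have x1 := mul_le_mul_of_nonneg_left v1 hp
  have x2 : 0 ≤ t * μ.real E := by positivity
  linarith

/-- approximability by levels -/
def Appr (A : Set X) : Prop := ∀ ε > 0, ∃ J, ∀ j ≥ J, ∃ F ⊆ Finset.range (C.h j + 1),
  μ.real (A ∆ lv C (C.E j) F) < ε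

lemma appr_compl {A : Set X} (hA : Appr C A) : Appr C Aᶜ := by
  intro ε hε
  obtain ⟨J, hJ⟩ := hA (ε/2) (by positivity)
  have h1 : Tendsto (fun j => μ.real (lv C (C.E j) (Finset.range (C.h j + 1)))) atTop (𝓝 1) :=
    (ENNReal.tendsto_toReal ENNReal.one_ne_top).comp C.tower_full
  obtain ⟨J', hJ'⟩ := eventually_atTop.1 (h1.eventually (lt_mem_nhds (show 1 - ε/2 < 1 by linarith)))
  refine ⟨max (max J J') 1, fun j hj => ?_⟩
  obtain ⟨F, hF, hFA⟩ := hJ j (by omega)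
  refine ⟨Finset.range (C.h j + 1) \ F, Finset.sdiff_subset, ?_⟩
  have h2 := hJ' j (by omega)
  have h3 := measureReal_compl (μ := μ) (lv_meas C (C.measE j) (Finset.range (C.h j + 1)))
  have hs : Aᶜ ∆ lv C (C.E j) (Finset.range (C.h j + 1) \ F) ⊆
      A ∆ lv C (C.E j) F ∪ (lv C (C.E j) (Finset.range (C.h j + 1)))ᶜ := by
    intro x hx
    by_cases hY : x ∈ lv C (C.E j) (Finset.range (C.h j + 1))
    · left
      have : x ∈ lv C (C.E j) (Finset.range (C.h j + 1) \ F) ↔ x ∉ lv C (C.E j) F := by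
        rw [mem_lv] at hY
        obtain ⟨l, hl, hx⟩ := hY
        have hu : ∀ i ∈ Finset.range (C.h j + 1), x ∈ (⇑C.T)^[i] '' C.E j → i = l := by
          intro i hi hx'
          by_contra hne
          rw [Finset.mem_range] at hi hl
          exact Set.disjoint_left.1
            (C.tower_disjoint j (by omega) i (by omega) l (by omega) hne) hx' hx
        rw [mem_lv, mem_lv]
        constructor
        · rintro ⟨i, hi, hxi⟩ ⟨i', hi', hxi'⟩
          rw [Finset.mem_sdiff] at hi
          have e1 := hu i hi.1 hxi
          have e2 := hu i' (hF hi') hxi'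
          subst e1; subst e2; exact hi.2 hi'
        · intro h
          exact ⟨l, Finset.mem_sdiff.2 ⟨hl, fun hlF => h ⟨l, hlF, hx⟩⟩, hx⟩
      simp only [Set.mem_symmDiff, Set.mem_compl_iff, this] at hx ⊢
      tauto
    · right; exact hY
  have h4 := (measureReal_mono (μ := μ) hs).trans (measureReal_union_le _ _)
  rw [probReal_univ] at h3
  linarith

lemma appr_union {A B : Set X} (hA : Appr C A) (hB : Appr C B) : Appr C (A ∪ B) := by
  classical
  intro ε hε
  obtain ⟨J, hJ⟩ := hA (ε/2) (by positivity)
  obtain ⟨J', hJ'⟩ := hB (ε/2) (by positivity)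
  refine ⟨max J J', fun j hj => ?_⟩
  obtain ⟨F, hF, hFA⟩ := hJ j (by omega)
  obtain ⟨G, hG, hGB⟩ := hJ' j (by omega)
  refine ⟨F ∪ G, Finset.union_subset hF hG, ?_⟩
  have hs : (A ∪ B) ∆ lv C (C.E j) (F ∪ G) ⊆ A ∆ lv C (C.E j) F ∪ B ∆ lv C (C.E j) G := by
    have : lv C (C.E j) (F ∪ G) = lv C (C.E j) F ∪ lv C (C.E j) G := Finset.set_biUnion_union _ _ _
    rw [this]
    intro x hx
    simp only [Set.mem_symmDiff, Set.mem_union] at hx ⊢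
    tauto
  have h4 := (measureReal_mono (μ := μ) hs).trans (measureReal_union_le _ _)
  linarith

lemma appr_empty : Appr C (∅ : Set X) := by
  intro ε hε
  exact ⟨0, fun j _ => ⟨∅, by simp, by simpa [lv] using hε⟩⟩

lemma appr_of_close {A : Set X} (h : ∀ ε > 0, ∃ B, Appr C B ∧ μ.real (A ∆ B) < ε) : Appr C A := by
  intro ε hε
  obtain ⟨B, hB, hAB⟩ := h (ε/2) (by positivity)
  obtain ⟨J, hJ⟩ := hB (ε/2) (by positivity)
  refine ⟨J, fun j hj => ?_⟩
  obtain ⟨F, hF, hFA⟩ := hJ j hj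
  refine ⟨F, hF, ?_⟩
  have := measureReal_symmDiff_le (μ := μ) (s := A) (t := B) (lv C (C.E j) F)
  linarith

lemma appr_iUnion {f : ℕ → Set X} (hm : ∀ n, MeasurableSet (f n)) (h : ∀ n, Appr C (f n)) :
    Appr C (⋃ n, f n) := by
  apply appr_of_close
  intro ε hε
  have hacc : ∀ n, Appr C (Set.accumulate f n) := by
    intro n
    induction n with
    | zero => simpa using h 0
    | succ n ih => rw [Set.accumulate_succ]; exact appr_union C ih (h _)
  have ht := tendsto_measure_iUnion_accumulate (μ := μ) (f := f)
  have ht' : Tendsto (fun n => μ.real (Set.accumulate f n)) atTop (𝓝 (μ.real (⋃ n, f n))) :=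
    (ENNReal.tendsto_toReal (measure_ne_top _ _)).comp ht
  obtain ⟨n, hn⟩ := (ht'.eventually (lt_mem_nhds (show μ.real (⋃ n, f n) - ε < _ by linarith))).exists
  refine ⟨_, hacc n, ?_⟩
  have hsub : Set.accumulate f n ⊆ ⋃ n, f n := by
    rw [← Set.iUnion_accumulate]; exact Set.subset_iUnion _ n
  have hmm : MeasurableSet (Set.accumulate f n) := by
    rw [Set.accumulate_def]
    exact MeasurableSet.biUnion (Set.to_countable _) fun i _ => hm i
  have : (⋃ n, f n) ∆ Set.accumulate f n = (⋃ n, f n) \ Set.accumulate f n := by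
    ext x
    have := @hsub x
    simp only [Set.mem_symmDiff, Set.mem_sdiff]
    tauto
  rw [this, measureReal_sdiff hsub hmm]
  linarith

lemma level_step (j : ℕ) (hj : 1 ≤ j) {A : Set X} {F : Finset ℕ}
    (hF : F ⊆ Finset.range (C.h j + 1)) (hA : A =ᵐ[μ] lv C (C.E j) F) :
    ∃ G ⊆ Finset.range (C.h (j+1) + 1), A =ᵐ[μ] lv C (C.E (j+1)) G := by
  classical
  have hH := H_succ C j hj
  refine ⟨F ∪ (F.image (· + (C.h j + 1)) ∪ F.image (· + ((C.h j + 1 + s j) + (C.h j + 1)))), ?_, ?_⟩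
  · intro l hl
    simp only [Finset.mem_union, Finset.mem_image] at hl
    rw [Finset.mem_range]
    rcases hl with hl | ⟨a, ha, rfl⟩ | ⟨a, ha, rfl⟩
    · have := Finset.mem_range.1 (hF hl); omega
    · have := Finset.mem_range.1 (hF ha); omega
    · have := Finset.mem_range.1 (hF ha); omega
  · refine hA.trans ?_
    have e1 : ∀ l, ∀ᵐ x ∂μ, x ∈ (⇑C.T)^[l + (C.h j + 1)] '' C.E (j+1) ↔ x ∈ (⇑C.T)^[l] '' C.E2 j := by
      intro l
      rw [← img_img]
      exact (ae_eq_img _ C.measurePreserving l (E1_eq2 C j hj)).mem_iff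
    have e2 : ∀ l, ∀ᵐ x ∂μ, x ∈ (⇑C.T)^[l + ((C.h j + 1 + s j) + (C.h j + 1))] '' C.E (j+1) ↔
        x ∈ (⇑C.T)^[l] '' C.E3 j := by
      intro l
      rw [← img_img]
      exact (ae_eq_img _ C.measurePreserving l (E1_eq3 C j hj)).mem_iff
    rw [← ae_all_iff] at e1 e2
    rw [Filter.eventuallyEq_set]
    filter_upwards [e1, e2] with x h1 h2
    have h0 : ∀ l, x ∈ (⇑C.T)^[l] '' C.E j ↔ x ∈ (⇑C.T)^[l] '' C.E (j+1) ∨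
        x ∈ (⇑C.T)^[l] '' C.E2 j ∨ x ∈ (⇑C.T)^[l] '' C.E3 j := by
      intro l
      rw [C.E_union j hj, C.E_next j hj, Set.image_union, Set.image_union]
      simp only [Set.mem_union, or_assoc]
    rw [mem_lv, mem_lv]
    simp only [h0, ← h1, ← h2, Finset.mem_union, Finset.mem_image]
    constructor
    · rintro ⟨l, hl, h | h | h⟩
      · exact ⟨l, Or.inl hl, h⟩
      · exact ⟨_, Or.inr (Or.inl ⟨l, hl, rfl⟩), h⟩
      · exact ⟨_, Or.inr (Or.inr ⟨l, hl, rfl⟩), h⟩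
    · rintro ⟨l, hl | ⟨a, ha, rfl⟩ | ⟨a, ha, rfl⟩, h⟩
      · exact ⟨l, hl, Or.inl h⟩
      · exact ⟨a, ha, Or.inr (Or.inl h)⟩
      · exact ⟨a, ha, Or.inr (Or.inr h)⟩

lemma appr_level (j : ℕ) (hj : 1 ≤ j) (i : ℕ) (hi : i ≤ C.h j) : Appr C ((⇑C.T)^[i] '' C.E j) := by
  intro ε hε
  refine ⟨j, fun j' hj' => ?_⟩
  have : ∃ G ⊆ Finset.range (C.h j' + 1), ((⇑C.T)^[i] '' C.E j : Set X) =ᵐ[μ] lv C (C.E j') G := by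
    induction j', hj' using Nat.le_induction with
    | base => exact ⟨{i}, by simpa using by omega, by simp only [lv, Finset.mem_singleton, Set.iUnion_iUnion_eq_left]; rfl⟩
    | succ k hk ih =>
      obtain ⟨G, hG, h⟩ := ih
      exact level_step C k (by omega) hG h
  obtain ⟨G, hG, h⟩ := this
  refine ⟨G, hG, ?_⟩
  rw [Measure.real, measure_symmDiff_eq_zero_iff.2 h]
  simpa using hε

lemma appr_all {A : Set X} (hA : MeasurableSet A) : Appr C A := by
  obtain ⟨B, hB, hAB⟩ := C.generates A hA
  apply appr_of_close
  intro ε hε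
  refine ⟨B, ?_, by simpa [Measure.real, hAB] using hε⟩
  clear hAB
  have : MeasurableSet B ∧ Appr C B := by
    induction B, hB using MeasurableSpace.generateFrom_induction with
    | hC t ht _ =>
      obtain ⟨j, hj, i, hi, rfl⟩ := ht
      exact ⟨img_meas _ _ (C.measE j), appr_level C j hj i hi⟩
    | empty => exact ⟨MeasurableSet.empty, appr_empty C⟩
    | compl t _ ih => exact ⟨ih.1.compl, appr_compl C ih.2⟩
    | iUnion f _ ih => exact ⟨MeasurableSet.iUnion fun n => (ih n).1,
        appr_iUnion C (fun n => (ih n).1) fun n => (ih n).2⟩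
  exact this.2

lemma h_ge (j : ℕ) (hj : 1 ≤ j) : j ≤ C.h j := by
  induction j, hj using Nat.le_induction with
  | base => rw [C.h_one]
  | succ j hj ih => rw [C.h_succ j hj]; omega

lemma E_small (j : ℕ) (hj : 1 ≤ j) : j * μ.real (C.E j) ≤ 1 := by
  have h1 := lv_real C j hj (C.measE j) subset_rfl (subset_refl (Finset.range (C.h j + 1)))
  have h2 : μ.real (lv C (C.E j) (Finset.range (C.h j + 1))) ≤ 1 := measureReal_le_one
  rw [h1, Finset.card_range] at h2
  refine le_trans ?_ h2
  gcongr
  exact (h_ge C j hj).trans (by omega)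

end chacon

section root
variable {X : Type*} [MeasurableSpace X] {μ : Measure X} [IsProbabilityMeasure μ]
  (C : ChaconMap μ (fun j => Nat.sqrt j))

/-- the times at which the power is close to the half sum -/
def phi (n : ℕ) : ℕ := C.h (n * n) + 1

lemma key_lower {A B : Set X} (hA : MeasurableSet A) (hB : MeasurableSet B) {ε : ℝ} (hε : 0 < ε) :
    ∀ᶠ n : ℕ in atTop, (1/2) * μ.real (A ∩ B) + (1/2) * μ.real (A ∩ (⇑C.T)^[n] '' B)
      ≤ μ.real ((⇑C.T)^[phi C n] '' A ∩ B) + ε := by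
  obtain ⟨J, hJ⟩ := appr_all C hA (ε/8) (by positivity)
  obtain ⟨J', hJ'⟩ := appr_all C hB (ε/8) (by positivity)
  have l1 : ∀ᶠ n : ℕ in atTop, (1/3 : ℝ)^n < ε/4 :=
    (tendsto_pow_atTop_nhds_zero_of_lt_one (by norm_num) (by norm_num)).eventually
      (gt_mem_nhds (by positivity))
  have l2 : ∀ᶠ n : ℕ in atTop, 1 / (n : ℝ) < ε/4 :=
    tendsto_one_div_atTop_nhds_zero_nat.eventually (gt_mem_nhds (by positivity))
  filter_upwards [l1, l2, eventually_ge_atTop (max (max J J') 1)] with n h1 h2 hn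
  have hn1 : 1 ≤ n := by omega
  have hnn : n ≤ n * n := Nat.le_mul_self n
  obtain ⟨F, hF, hFA⟩ := hJ (n*n) (by omega)
  obtain ⟨G, hG, hGB⟩ := hJ' (n*n) (by omega)
  have hl := lower C (n*n) (by omega) n n (fun i hi => Nat.sqrt_add_eq n (by omega)) hn1
    (hnn.trans (h_ge C _ (by omega))) hF hG
  set A' := lv C (C.E (n*n)) F
  set B' := lv C (C.E (n*n)) G
  have hE : n * μ.real (C.E (n*n)) ≤ 1 / (n:ℝ) := by
    have := E_small C (n*n) (by omega)
    rw [le_div_iff₀ (by exact_mod_cast hn1)]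
    push_cast at this
    linarith
  have i1 := inter_le (μ := μ) A A' B B'
  have i2 := inter_le (μ := μ) A A' ((⇑C.T)^[n] '' B) ((⇑C.T)^[n] '' B')
  rw [← img_symmDiff, img_real C.T C.measurePreserving] at i2
  have i3 := inter_le (μ := μ) ((⇑C.T)^[phi C n] '' A') ((⇑C.T)^[phi C n] '' A) B' B
  rw [← img_symmDiff, img_real C.T C.measurePreserving, symmDiff_comm A', symmDiff_comm B'] at i3
  change _ ≤ μ.real ((⇑C.T)^[phi C n] '' A' ∩ B') + _ + _ at hl
  linarith

lemma key {A B : Set X} (hA : MeasurableSet A) (hB : MeasurableSet B) :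
    Tendsto (fun n => μ.real ((⇑C.T)^[phi C n] '' A ∩ B) -
      ((1/2) * μ.real (A ∩ B) + (1/2) * μ.real (A ∩ (⇑C.T)^[n] '' B))) atTop (𝓝 0) := by
  rw [Metric.tendsto_nhds]
  intro ε hε
  filter_upwards [key_lower C hA hB (half_pos hε), key_lower C hA hB.compl (half_pos hε)]
    with n h1 h2
  have c1 := measureReal_inter_add_sdiff (μ := μ) (s := A) hB
  have c2 := measureReal_inter_add_sdiff (μ := μ) (s := A) (img_meas C.T n hB)
  have c3 := measureReal_inter_add_sdiff (μ := μ) (s := ((⇑C.T)^[phi C n] '' A)) hB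
  rw [img_real C.T C.measurePreserving] at c3
  rw [Set.image_compl_eq (C.T.bijective.iterate n), ← Set.sdiff_eq, ← Set.sdiff_eq, ← Set.sdiff_eq] at h2
  rw [Real.dist_eq, abs_lt]
  constructor <;> linarith

/-- the rigidity sequence -/
def rig : ℕ → ℕ
  | 0 => 1
  | i + 1 => phi C (rig i)

lemma phi_gt (n : ℕ) (hn : 1 ≤ n) : n < phi C n := by
  have hnn : n ≤ n * n := Nat.le_mul_self n
  have := h_ge C (n*n) (by omega)
  unfold phi; omega

lemma rig_ge (i : ℕ) : i + 1 ≤ rig C i := by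
  induction i with
  | zero => simp [rig]
  | succ i ih =>
    have := phi_gt C (rig C i) (by omega)
    rw [rig]; omega

lemma rig_tendsto : Tendsto (rig C) atTop atTop :=
  tendsto_atTop_mono (fun i => (Nat.le_succ i).trans (rig_ge C i)) tendsto_id

lemma phi_tendsto : Tendsto (phi C) atTop atTop := by
  refine tendsto_atTop_mono' _ ?_ tendsto_id
  filter_upwards [eventually_ge_atTop 1] with n hn using (phi_gt C n hn).le

lemma rigid {A : Set X} (hA : MeasurableSet A) :
    Tendsto (fun i => μ.real (((⇑C.T)^[rig C i] '' A) ∆ A)) atTop (𝓝 0) := by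
  have h0 : ∀ k, μ.real (((⇑C.T)^[k] '' A) ∆ A)
      = 2 * (μ.real A - μ.real ((⇑C.T)^[k] '' A ∩ A)) := by
    intro k
    have mI := img_meas C.T k hA
    have c1 := measureReal_inter_add_sdiff (μ := μ) (s := ((⇑C.T)^[k] '' A)) hA
    have c2 := measureReal_inter_add_sdiff (μ := μ) (s := A) mI
    rw [img_real C.T C.measurePreserving] at c1
    rw [Set.inter_comm] at c2
    rw [measureReal_symmDiff_eq (μ := μ) mI hA]
    linarith
  have h1 : Tendsto (fun i => μ.real A - μ.real ((⇑C.T)^[rig C i] '' A ∩ A)) atTop (𝓝 0) := by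
    apply real_seq
    · intro i
      have a1 : μ.real ((⇑C.T)^[rig C i] '' A ∩ A) ≤ μ.real A := measureReal_mono Set.inter_subset_right
      have a2 : μ.real A ≤ 1 := measureReal_le_one
      have a3 : 0 ≤ μ.real ((⇑C.T)^[rig C i] '' A ∩ A) := measureReal_nonneg
      rw [abs_le]; constructor <;> linarith
    · have := ((key C hA hA).comp (rig_tendsto C)).neg
      rw [neg_zero] at this
      refine this.congr fun i => ?_
      simp only [Function.comp, rig, Set.inter_self]
      rw [Set.inter_comm A ((⇑C.T)^[rig C i] '' A)]
      ring
  simp only [h0]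
  simpa using h1.const_mul 2

end root
end ChaconAux

/-- for the root Chacon map and any `p` there are powers converging
weakly to `½ I + ½ Tᵖ`. -/
theorem rootChacon_weak_limit_half_I_half_Tp
    {X : Type*} [MeasurableSpace X] (μ : Measure X) [IsProbabilityMeasure μ]
    (C : ChaconMap μ (fun j => Nat.sqrt j)) (p : ℕ) :
    ∃ q : ℕ → ℕ, Tendsto q atTop atTop ∧
      ∀ A B : Set X, MeasurableSet A → MeasurableSet B →
        Tendsto (fun k => (μ ((⇑C.T)^[q k] '' A ∩ B)).toReal) atTop
          (𝓝 ((1 / 2) * (μ (A ∩ B)).toReal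
            + (1 / 2) * (μ ((⇑C.T)^[p] '' A ∩ B)).toReal)) := by
  have key := fun {A B : Set X} => ChaconAux.key C (A := A) (B := B)
  have rigid := fun {A : Set X} => ChaconAux.rigid C (A := A)
  have hrig := ChaconAux.rig_tendsto C
  have hphi := ChaconAux.phi_tendsto C
  set m := ChaconAux.rig C with hm
  set φ := ChaconAux.phi C with hφ
  have hn : Tendsto (fun i => m i - p) atTop atTop := (tendsto_sub_atTop_nat p).comp hrig
  refine ⟨fun i => φ (m i - p) + m i, tendsto_atTop_mono (fun i => Nat.le_add_left _ _) hrig, ?_⟩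
  intro A B hA hB
  have k1 := (key hA hB).comp hn
  have r1 := rigid hA
  have r2 := rigid hB
  change Tendsto (fun k => μ.real ((⇑C.T)^[φ (m k - p) + m k] '' A ∩ B)) atTop
    (𝓝 ((1/2) * μ.real (A ∩ B) + (1/2) * μ.real ((⇑C.T)^[p] '' A ∩ B)))
  rw [tendsto_iff_dist_tendsto_zero]
  have hsum := (r1.add (k1.abs)).add r2
  simp only [abs_zero, add_zero] at hsum
  refine squeeze_zero' (Eventually.of_forall fun _ => dist_nonneg) ?_ hsum
  filter_upwards [hrig.eventually_ge_atTop p] with i hi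
  obtain ⟨n, hn'⟩ := Nat.exists_eq_add_of_le hi
  have hsub : m i - p = n := by omega
  simp only [Function.comp, hsub]
  have e1 : μ.real (A ∩ (⇑C.T)^[n] '' B) = μ.real ((⇑C.T)^[p] '' A ∩ (⇑C.T)^[m i] '' B) := by
    rw [hn', ← ChaconAux.img_img, ← ChaconAux.img_inter, ChaconAux.img_real C.T C.measurePreserving]
  have s1 := ChaconAux.inter_le (μ := μ) ((⇑C.T)^[φ n + m i] '' A) ((⇑C.T)^[φ n] '' A) B B
  have s2 := ChaconAux.inter_le (μ := μ) ((⇑C.T)^[φ n] '' A) ((⇑C.T)^[φ n + m i] '' A) B B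
  rw [symmDiff_comm ((⇑C.T)^[φ n] '' A)] at s2
  rw [← ChaconAux.img_img, ← ChaconAux.img_symmDiff, ChaconAux.img_real C.T C.measurePreserving,
    symmDiff_self, Set.bot_eq_empty, measureReal_empty] at s1 s2
  have s3 := ChaconAux.inter_le (μ := μ) ((⇑C.T)^[p] '' A) ((⇑C.T)^[p] '' A) B ((⇑C.T)^[m i] '' B)
  have s4 := ChaconAux.inter_le (μ := μ) ((⇑C.T)^[p] '' A) ((⇑C.T)^[p] '' A) ((⇑C.T)^[m i] '' B) B
  rw [symmDiff_comm B] at s3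
  rw [symmDiff_self, Set.bot_eq_empty, measureReal_empty] at s3 s4
  rw [e1, ← ChaconAux.img_img, Real.dist_eq]
  set a := μ.real ((⇑C.T)^[φ n] '' A ∩ B) -
    ((1/2) * μ.real (A ∩ B) + (1/2) * μ.real ((⇑C.T)^[p] '' A ∩ (⇑C.T)^[m i] '' B)) with ha
  have ha1 := le_abs_self a
  have ha2 := neg_abs_le a
  have hnn : 0 ≤ μ.real (((⇑C.T)^[m i] '' B) ∆ B) := measureReal_nonneg
  rw [abs_le]
  constructor <;> linarith
end

section
/- The root Chacon map T possesses all polynomial weak limits of its powers: for every m ≥ 0, all natural numbers p_0 < p_1 < … < p_m, and all nonnegative reals a_0, …, a_m with a_0 + … + a_m = 1, there exists a sequence q(k) → ∞ such that for all measurable sets A, B ⊆ X, μ(T^{q(k)}A ∩ B) → Σ_{i=0}^m a_i μ(T^{p_i}A ∩ B) as k → ∞. -/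
open MeasureTheory Filter Topology
open scoped symmDiff

set_option linter.unusedSectionVars false

namespace RootChacon

/-- Closed midpoint-convex sets are convex. -/
lemma convex_of_midpoint {V : Type*} [AddCommGroup V] [Module ℝ V] [TopologicalSpace V]
    [IsTopologicalAddGroup V] [ContinuousSMul ℝ V] {S : Set V} (hS : IsClosed S)
    (hm : ∀ x ∈ S, ∀ y ∈ S, (1 / 2 : ℝ) • x + (1 / 2 : ℝ) • y ∈ S) : Convex ℝ S := by
  intro x hx y hy a b ha hb hab
  have hcont : Continuous (fun t : ℝ => (1 - t) • x + t • y) := by fun_prop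
  have hK : IsClosed {t : ℝ | (1 - t) • x + t • y ∈ S} := hS.preimage hcont
  have hmid : ∀ s t : ℝ, (1 - s) • x + s • y ∈ S → (1 - t) • x + t • y ∈ S →
      (1 - (s + t) / 2) • x + ((s + t) / 2) • y ∈ S := by
    intro s t hs ht
    have := hm _ hs _ ht
    convert this using 1
    module
  have hind : ∀ n : ℕ, ∃ s t : ℝ, ((1 - s) • x + s • y ∈ S) ∧ ((1 - t) • x + t • y ∈ S) ∧
      s ≤ b ∧ b ≤ t ∧ t - s ≤ (1 / 2) ^ n := by
    intro n
    induction n with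
    | zero => exact ⟨0, 1, by simpa using hx, by simpa using hy, hb, by linarith, by norm_num⟩
    | succ n ih =>
      obtain ⟨s, t, hs, ht, h1, h2, h3⟩ := ih
      have hst := hmid s t hs ht
      rcases le_total ((s + t) / 2) b with h | h
      · refine ⟨(s + t) / 2, t, hst, ht, h, h2, ?_⟩
        rw [pow_succ]; linarith
      · refine ⟨s, (s + t) / 2, hs, hst, h1, h, ?_⟩
        rw [pow_succ]; linarith
  choose s t hs ht h1 h2 h3 using hind
  have hlim : Tendsto s atTop (𝓝 b) := by
    have h0 : Tendsto (fun n : ℕ => b - (1 / 2 : ℝ) ^ n) atTop (𝓝 (b - 0)) :=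
      tendsto_const_nhds.sub (tendsto_pow_atTop_nhds_zero_of_lt_one (by norm_num) (by norm_num))
    rw [sub_zero] at h0
    refine tendsto_of_tendsto_of_tendsto_of_le_of_le h0 tendsto_const_nhds ?_ h1
    intro n
    have := h2 n; have := h3 n
    simp only
    linarith
  have := hK.mem_of_tendsto hlim (Eventually.of_forall hs)
  have ha' : a = 1 - b := by linarith
  rw [ha']; exact this

section abs
variable {I : Type*}

/-- limit points of `U n` as `n → +∞`. -/
def Lim (U : ℤ → I → ℝ) : Set (I → ℝ) := {φ | MapClusterPt φ atTop (fun n : ℕ => U n)}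

lemma isClosed_Lim (U : ℤ → I → ℝ) : IsClosed (Lim U) := isClosed_setOfPred_clusterPt

lemma step (U : ℤ → I → ℝ) (H : ℕ → ℕ) (hH : Tendsto H atTop atTop)
    (K : ∀ c : ℤ, Tendsto (fun v : ℕ => U (c - H v) - ((1 / 2 : ℝ) • U c + (1 / 2 : ℝ) • U (c + v)))
      atTop (𝓝 0)) (c : ℤ) {φ : I → ℝ} (hφ : φ ∈ Lim U) :
    (1 / 2 : ℝ) • U c + (1 / 2 : ℝ) • φ ∈ Lim (fun n => U (-n)) := by
  obtain ⟨F, hF, hlim⟩ := mapClusterPt_iff_ultrafilter.1 hφ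
  have hv : Tendsto (fun n : ℕ => ((n : ℤ) - c).toNat) atTop atTop := by
    refine tendsto_atTop.2 fun b => ?_
    filter_upwards [eventually_ge_atTop ((b : ℤ) + c).toNat] with n hn
    omega
  have hm : Tendsto (fun n : ℕ => ((H ((n : ℤ) - c).toNat : ℤ) - c).toNat) atTop atTop := by
    refine tendsto_atTop.2 fun b => ?_
    filter_upwards [(hH.comp hv).eventually_ge_atTop ((b : ℤ) + c).toNat] with n hn
    simp only [Function.comp] at hn
    omega
  refine MapClusterPt.of_comp (hm.mono_left hF) ?_
  have key : Tendsto (fun n : ℕ => (U (c - H ((n : ℤ) - c).toNat)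
      - ((1 / 2 : ℝ) • U c + (1 / 2 : ℝ) • U (c + ((n : ℤ) - c).toNat)))
      + ((1 / 2 : ℝ) • U c + (1 / 2 : ℝ) • U n)) F
      (𝓝 (0 + ((1 / 2 : ℝ) • U c + (1 / 2 : ℝ) • φ))) := by
    refine Tendsto.add (((K c).comp hv).mono_left hF) ?_
    exact tendsto_const_nhds.add (hlim.const_smul _)
  rw [zero_add] at key
  refine Tendsto.mapClusterPt (key.congr' ?_)
  have e1 : ∀ᶠ n : ℕ in F, c.toNat ≤ n := hF (eventually_ge_atTop _)
  have e2 : ∀ᶠ n : ℕ in F, c.toNat ≤ H ((n : ℤ) - c).toNat :=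
    hF ((hH.comp hv).eventually_ge_atTop c.toNat)
  filter_upwards [e1, e2] with n h1 h2
  have a1 : c + ((((n : ℤ) - c).toNat : ℕ) : ℤ) = n := by omega
  have a2 : -((((H ((n : ℤ) - c).toNat : ℤ) - c).toNat : ℕ) : ℤ) = c - H ((n : ℤ) - c).toNat := by
    omega
  simp only [Function.comp]
  rw [a1, a2]
  abel

lemma step2 (U : ℤ → I → ℝ) (H : ℕ → ℕ) (hH : Tendsto H atTop atTop)
    (K : ∀ c : ℤ, Tendsto (fun v : ℕ => U (c - H v) - ((1 / 2 : ℝ) • U c + (1 / 2 : ℝ) • U (c + v)))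
      atTop (𝓝 0)) {φ ψ : I → ℝ} (hψ : ψ ∈ Lim U) (hφ : φ ∈ Lim U) :
    (1 / 2 : ℝ) • ψ + (1 / 2 : ℝ) • φ ∈ Lim (fun n => U (-n)) := by
  obtain ⟨F, hF, hlim⟩ := mapClusterPt_iff_ultrafilter.1 hψ
  refine (isClosed_Lim _).mem_of_tendsto (b := (F : Filter ℕ))
    ((hlim.const_smul (1 / 2 : ℝ)).add tendsto_const_nhds) ?_
  exact Eventually.of_forall fun n => step U H hH K n hφ

lemma abstract_main (U : ℤ → I → ℝ) (hb : ∀ n i, U n i ∈ Set.Icc (0 : ℝ) 1)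
    (H : ℕ → ℕ) (hH : Tendsto H atTop atTop)
    (K1 : ∀ c : ℤ, Tendsto
      (fun v : ℕ => U (c - H v) - ((1 / 2 : ℝ) • U c + (1 / 2 : ℝ) • U (c + v))) atTop (𝓝 0))
    (K2 : ∀ c : ℤ, Tendsto
      (fun v : ℕ => U (c + H v) - ((1 / 2 : ℝ) • U c + (1 / 2 : ℝ) • U (c - v))) atTop (𝓝 0)) :
    Convex ℝ (Lim U) ∧ ∀ c, U c ∈ Lim U := by
  have K2' : ∀ c : ℤ, Tendsto (fun v : ℕ => (fun n => U (-n)) (c - H v)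
      - ((1 / 2 : ℝ) • (fun n => U (-n)) c + (1 / 2 : ℝ) • (fun n => U (-n)) (c + v)))
      atTop (𝓝 0) := by
    intro c
    refine (K2 (-c)).congr fun v => ?_
    simp only
    rw [show -c + (H v : ℤ) = -(c - H v) by ring, show -c - (v : ℤ) = -(c + v) by ring]
  have half : ∀ x : I → ℝ, (1 / 2 : ℝ) • x + (1 / 2 : ℝ) • x = x := fun x => by module
  have pm : ∀ φ ∈ Lim U, φ ∈ Lim (fun n => U (-n)) := fun φ h => by
    have := step2 U H hH K1 h h
    rwa [half] at this
  have mp : ∀ φ ∈ Lim (fun n => U (-n)), φ ∈ Lim U := fun φ h => by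
    have := step2 _ H hH K2' h h
    rw [half] at this
    simpa using this
  refine ⟨convex_of_midpoint (isClosed_Lim U) fun x hx y hy => mp _ (step2 U H hH K1 hx hy), ?_⟩
  obtain ⟨φ, -, hφ⟩ := (isCompact_univ_pi (fun _ : I => isCompact_Icc (a := (0 : ℝ)) (b := 1))).exists_mapClusterPt
    (f := atTop) (u := fun n : ℕ => U n)
    (by exact tendsto_principal.2 (Eventually.of_forall fun n => by
          intro i _; exact hb n i))
  intro c
  have hn : ∀ n : ℕ, U c + ((1 / 2 : ℝ) ^ n) • (φ - U c) ∈ Lim U := by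
    intro n
    induction n with
    | zero =>
      have h0 : φ ∈ Lim U := hφ
      simpa using h0
    | succ n ih =>
      have := mp _ (step U H hH K1 c ih)
      convert this using 1
      rw [pow_succ]
      module
  have hl : Tendsto (fun n : ℕ => U c + ((1 / 2 : ℝ) ^ n) • (φ - U c)) atTop
      (𝓝 (U c + (0 : ℝ) • (φ - U c))) :=
    tendsto_const_nhds.add ((tendsto_pow_atTop_nhds_zero_of_lt_one
      (by norm_num) (by norm_num)).smul_const _)
  rw [zero_smul, add_zero] at hl
  exact (isClosed_Lim U).mem_of_tendsto hl (Eventually.of_forall hn)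

end abs
end RootChacon

namespace RootChacon

section tau
variable {X : Type*} [MeasurableSpace X] {μ : Measure X}

/-- the `n`-th power of `T` (as a permutation), `n ∈ ℤ`. -/
def pw (T : X ≃ᵐ X) (n : ℤ) : Equiv.Perm X := (T.toEquiv : Equiv.Perm X) ^ n

/-- image of a set under the `n`-th power of `T`. -/
def tau (T : X ≃ᵐ X) (n : ℤ) (A : Set X) : Set X := pw T n '' A

lemma pw_nat (T : X ≃ᵐ X) (n : ℕ) : ⇑(pw T n) = (⇑T)^[n] := by
  simp only [pw, zpow_natCast]
  rw [Equiv.Perm.coe_pow]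
  rfl

lemma pw_neg_nat (T : X ≃ᵐ X) (n : ℕ) : ⇑(pw T (-n)) = (⇑T.symm)^[n] := by
  simp only [pw, zpow_neg, zpow_natCast]
  rw [← inv_pow, Equiv.Perm.coe_pow]
  rfl

lemma pw_mp {T : X ≃ᵐ X} (hT : MeasurePreserving T μ μ) (n : ℤ) :
    MeasurePreserving (pw T n) μ μ := by
  rcases Int.eq_nat_or_neg n with ⟨k, rfl | rfl⟩
  · rw [pw_nat]; exact hT.iterate k
  · rw [pw_neg_nat]; exact (MeasurePreserving.symm T hT).iterate k

lemma tau_eq_preimage (T : X ≃ᵐ X) (n : ℤ) (A : Set X) : tau T n A = pw T (-n) ⁻¹' A := by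
  unfold tau
  rw [Equiv.image_eq_preimage_symm]
  congr 1
  simp only [pw, zpow_neg]
  rfl

lemma tau_nat (T : X ≃ᵐ X) (n : ℕ) (A : Set X) : tau T n A = (⇑T)^[n] '' A := by
  unfold tau; rw [pw_nat]

lemma tau_zero (T : X ≃ᵐ X) (A : Set X) : tau T 0 A = A := by
  simp [tau, pw]

lemma tau_add (T : X ≃ᵐ X) (m n : ℤ) (A : Set X) : tau T (m + n) A = tau T m (tau T n A) := by
  unfold tau pw
  rw [zpow_add, Equiv.Perm.coe_mul, Set.image_comp]

lemma tau_inter (T : X ≃ᵐ X) (n : ℤ) (A B : Set X) :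
    tau T n (A ∩ B) = tau T n A ∩ tau T n B := by
  simp only [tau_eq_preimage, Set.preimage_inter]

lemma tau_union (T : X ≃ᵐ X) (n : ℤ) (A B : Set X) :
    tau T n (A ∪ B) = tau T n A ∪ tau T n B := by
  simp only [tau_eq_preimage, Set.preimage_union]

lemma tau_symmDiff (T : X ≃ᵐ X) (n : ℤ) (A B : Set X) :
    tau T n (A ∆ B) = tau T n A ∆ tau T n B := by
  simp only [tau_eq_preimage, Set.preimage_symmDiff]

lemma tau_mono (T : X ≃ᵐ X) (n : ℤ) {A B : Set X} (h : A ⊆ B) : tau T n A ⊆ tau T n B :=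
  Set.image_mono h

lemma tau_disjoint (T : X ≃ᵐ X) (n : ℤ) {A B : Set X} (h : Disjoint A B) :
    Disjoint (tau T n A) (tau T n B) := by
  simp only [tau_eq_preimage]; exact h.preimage _

lemma tau_measurable {T : X ≃ᵐ X} (hT : MeasurePreserving T μ μ) (n : ℤ) {A : Set X}
    (hA : MeasurableSet A) : MeasurableSet (tau T n A) := by
  rw [tau_eq_preimage]; exact (pw_mp hT _).measurable hA

lemma tau_measure {T : X ≃ᵐ X} (hT : MeasurePreserving T μ μ) (n : ℤ) {A : Set X}
    (hA : MeasurableSet A) : μ.real (tau T n A) = μ.real A := by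
  rw [tau_eq_preimage, Measure.real, Measure.real,
    (pw_mp hT _).measure_preimage hA.nullMeasurableSet]

lemma tau_ae {T : X ≃ᵐ X} (hT : MeasurePreserving T μ μ) (n : ℤ) {A B : Set X}
    (h : A =ᵐ[μ] B) : (tau T n A : Set X) =ᵐ[μ] tau T n B := by
  simp only [tau_eq_preimage]
  exact (pw_mp hT _).quasiMeasurePreserving.preimage_ae_eq h

/-- correlations -/
noncomputable def corr (μ : Measure X) (T : X ≃ᵐ X) (n : ℤ) (A B : Set X) : ℝ :=
  μ.real (tau T n A ∩ B)

lemma corr_add (T : X ≃ᵐ X) (m n : ℤ) (A B : Set X) :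
    corr μ T (m + n) A B = corr μ T m (tau T n A) B := by
  unfold corr; rw [tau_add]

lemma corr_neg {T : X ≃ᵐ X} (hT : MeasurePreserving T μ μ) (n : ℤ) {A B : Set X}
    (hA : MeasurableSet A) (hB : MeasurableSet B) :
    corr μ T (-n) A B = μ.real (A ∩ tau T n B) := by
  unfold corr
  rw [← tau_measure hT n ((tau_measurable hT _ hA).inter hB), tau_inter, ← tau_add]
  simp [tau_zero]

lemma corr_symm {T : X ≃ᵐ X} (hT : MeasurePreserving T μ μ) (n : ℤ) {A B : Set X}
    (hA : MeasurableSet A) (hB : MeasurableSet B) :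
    corr μ T n A B = corr μ T (-n) B A := by
  rw [corr_neg hT n hB hA, Set.inter_comm]; rfl

lemma corr_approx [IsProbabilityMeasure μ] {T : X ≃ᵐ X} (hT : MeasurePreserving T μ μ) (n : ℤ)
    {A B A' B' : Set X}
    (hA : MeasurableSet A) (hB : MeasurableSet B) (hA' : MeasurableSet A')
    (hB' : MeasurableSet B') :
    |corr μ T n A B - corr μ T n A' B'| ≤ μ.real (A ∆ A') + μ.real (B ∆ B') := by
  unfold corr
  have h1 := abs_measureReal_sub_le_measureReal_symmDiff (μ := μ)
    ((tau_measurable hT n hA).inter hB).nullMeasurableSet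
    ((tau_measurable hT n hA').inter hB').nullMeasurableSet
  refine h1.trans ?_
  have h2 : (tau T n A ∩ B) ∆ (tau T n A' ∩ B') ⊆ tau T n (A ∆ A') ∪ (B ∆ B') := by
    rw [tau_symmDiff]
    intro x
    simp only [Set.mem_symmDiff, Set.mem_inter_iff, Set.mem_union]
    tauto
  refine (measureReal_mono h2).trans ((measureReal_union_le _ _).trans ?_)
  rw [tau_measure hT n (hA.symmDiff hA')]

lemma corr_mem [IsProbabilityMeasure μ] (T : X ≃ᵐ X) (n : ℤ) (A B : Set X) :
    corr μ T n A B ∈ Set.Icc (0 : ℝ) 1 :=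
  ⟨measureReal_nonneg, measureReal_le_one⟩

end tau

section tower
variable {X : Type*} [MeasurableSpace X] {μ : Measure X} [IsProbabilityMeasure μ] {s : ℕ → ℕ}
  (C : ChaconMap μ s)

/-- number of levels of the `j`-th tower -/
def ht (j : ℕ) : ℕ := C.h j + 1

lemma ht_succ {j : ℕ} (hj : 1 ≤ j) : ht C (j + 1) = 3 * ht C j + s j := by
  unfold ht; rw [C.h_succ j hj]; ring

lemma ht_ge {j : ℕ} (hj : 1 ≤ j) : j ≤ ht C j := by
  induction j, hj using Nat.le_induction with
  | base => unfold ht; omega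
  | succ n hn ih => rw [ht_succ C hn]; omega

/-- union of the levels with index in `I` -/
def lvl (j : ℕ) (I : Finset ℕ) : Set X := ⋃ i ∈ I, tau C.T (i : ℤ) (C.E j)

lemma lvl_measurable (j : ℕ) (I : Finset ℕ) : MeasurableSet (lvl C j I) :=
  I.measurableSet_biUnion fun i _ => tau_measurable C.measurePreserving i (C.measE j)

lemma e1 {j : ℕ} (hj : 1 ≤ j) : (tau C.T (ht C j) (C.E1 j) : Set X) =ᵐ[μ] C.E2 j := by
  rw [tau_nat]; exact measure_symmDiff_eq_zero_iff.1 (C.stack1 j hj)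

lemma e2 {j : ℕ} (hj : 1 ≤ j) : (tau C.T (ht C j + s j) (C.E2 j) : Set X) =ᵐ[μ] C.E3 j := by
  have := measure_symmDiff_eq_zero_iff.1 (C.stack2 j hj)
  rw [← tau_nat] at this
  exact_mod_cast this

lemma m12 {j : ℕ} (hj : 1 ≤ j) : μ.real (C.E1 j) = μ.real (C.E2 j) := by
  unfold Measure.real; rw [C.E_meas12 j hj]

lemma m23 {j : ℕ} (hj : 1 ≤ j) : μ.real (C.E2 j) = μ.real (C.E3 j) := by
  unfold Measure.real; rw [C.E_meas23 j hj]

lemma m1 {j : ℕ} (hj : 1 ≤ j) : μ.real (C.E1 j) = μ.real (C.E j) / 3 := by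
  have h : μ.real (C.E j) = μ.real (C.E1 j) + μ.real (C.E2 j) + μ.real (C.E3 j) := by
    rw [C.E_union j hj, measureReal_union _ (C.measE3 j), measureReal_union (C.E_disj12 j hj) (C.measE2 j)]
    exact Disjoint.union_left (C.E_disj13 j hj) (C.E_disj23 j hj)
  have := m12 C hj; have := m23 C hj
  linarith

lemma E_anti {j : ℕ} (hj : 1 ≤ j) (t : ℕ) : C.E (j + t) ⊆ C.E j := by
  induction t with
  | zero => exact subset_rfl
  | succ t ih =>
    refine subset_trans ?_ ih
    rw [← add_assoc, C.E_next (j + t) (by omega), C.E_union (j + t) (by omega)]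
    exact fun x hx => Or.inl (Or.inl hx)

lemma E_meas {j : ℕ} (hj : 1 ≤ j) (t : ℕ) :
    μ.real (C.E (j + t)) = (1 / 3) ^ t * μ.real (C.E j) := by
  induction t with
  | zero => simp
  | succ t ih =>
    rw [← add_assoc, C.E_next (j + t) (by omega), m1 C (by omega), ih, pow_succ]
    ring

lemma lev_disj {j : ℕ} (hj : 1 ≤ j) {i i' : ℕ} (hi : i < ht C j) (hi' : i' < ht C j)
    (hne : i ≠ i') : Disjoint (tau C.T i (C.E j)) (tau C.T i' (C.E j)) := by
  rw [tau_nat, tau_nat]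
  exact C.tower_disjoint j hj i (by unfold ht at hi; omega) i' (by unfold ht at hi'; omega) hne

/-- decomposition of a correlation into levels -/
lemma inter_lvl {j : ℕ} (hj : 1 ≤ j) {I : Finset ℕ} (hI : I ⊆ Finset.range (ht C j))
    {A : Set X} (hA : MeasurableSet A) (k : ℤ) :
    μ.real (A ∩ tau C.T k (lvl C j I)) = ∑ i ∈ I, μ.real (A ∩ tau C.T (k + i) (C.E j)) := by
  have : A ∩ tau C.T k (lvl C j I) = ⋃ i ∈ I, A ∩ tau C.T (k + i) (C.E j) := by
    unfold lvl
    simp only [tau_add C.T k]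
    rw [tau_eq_preimage]
    simp only [Set.preimage_iUnion, Set.inter_iUnion, ← tau_eq_preimage]
  rw [this, measureReal_biUnion_finset]
  · intro a ha b hb hab
    have := lev_disj C hj (Finset.mem_range.1 (hI ha)) (Finset.mem_range.1 (hI hb)) hab
    have := tau_disjoint C.T k this
    simp only [← tau_add] at this
    exact this.mono Set.inter_subset_right Set.inter_subset_right
  · exact fun i _ => hA.inter (tau_measurable C.measurePreserving _ (C.measE j))

lemma lvl_inter {j : ℕ} (hj : 1 ≤ j) {I : Finset ℕ} (hI : I ⊆ Finset.range (ht C j))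
    {F : Set X} (hF : F ⊆ C.E j) (hFm : MeasurableSet F) {i : ℕ} (hi : i < ht C j) :
    μ.real (lvl C j I ∩ tau C.T i F) = if i ∈ I then μ.real F else 0 := by
  split_ifs with h
  · have : lvl C j I ∩ tau C.T i F = tau C.T i F := by
      apply Set.inter_eq_right.2
      refine (tau_mono C.T i hF).trans ?_
      exact Set.subset_biUnion_of_mem (u := fun i : ℕ => tau C.T (i : ℤ) (C.E j)) h
    rw [this, tau_measure C.measurePreserving _ hFm]
  · have : lvl C j I ∩ tau C.T i F = ∅ := by
      rw [← Set.disjoint_iff_inter_eq_empty]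
      unfold lvl
      simp only [Set.disjoint_iUnion_left]
      intro i' hi'
      have hne : i' ≠ i := fun e => h (e ▸ hi')
      exact (lev_disj C hj (Finset.mem_range.1 (hI hi')) hi hne).mono_right (tau_mono C.T i hF)
    rw [this]; simp

lemma lvl_inter_prop {j : ℕ} (hj : 1 ≤ j) {I : Finset ℕ} (hI : I ⊆ Finset.range (ht C j))
    {F : Set X} (hF : F ⊆ C.E j) (hFm : MeasurableSet F) {i : ℕ} (hi : i < ht C j) {θ : ℝ}
    (hθ : μ.real F = θ * μ.real (C.E j)) :
    μ.real (lvl C j I ∩ tau C.T i F) = θ * μ.real (lvl C j I ∩ tau C.T i (C.E j)) := by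
  rw [lvl_inter C hj hI hF hFm hi, lvl_inter C hj hI subset_rfl (C.measE j) hi]
  split_ifs <;> simp [hθ]

lemma ht_mul_le {j : ℕ} (hj : 1 ≤ j) : (ht C j : ℝ) * μ.real (C.E j) ≤ 1 := by
  have := inter_lvl C hj (subset_refl (Finset.range (ht C j))) MeasurableSet.univ 0
  have h2 : ∀ i ∈ Finset.range (ht C j),
      μ.real (Set.univ ∩ tau C.T (0 + (i : ℤ)) (C.E j)) = μ.real (C.E j) := by
    intro i _
    rw [Set.univ_inter, tau_measure C.measurePreserving _ (C.measE j)]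
  rw [Finset.sum_congr rfl h2] at this
  simp only [Finset.sum_const, Finset.card_range, nsmul_eq_mul] at this
  rw [← this]; exact measureReal_le_one

/-- one step of the recursion -/
lemma one_step {k : ℕ} (hk : 1 ≤ k) {A : Set X} (hA : MeasurableSet A) (i : ℤ) :
    μ.real (A ∩ tau C.T (i + ht C k) (C.E k)) = μ.real (A ∩ tau C.T i (C.E2 k))
      + μ.real (A ∩ tau C.T (i - s k) (C.E3 k))
      + μ.real (A ∩ tau C.T (i + ht C (k + 1)) (C.E (k + 1))) := by
  have hT := C.measurePreserving
  have d : ∀ n : ℤ, μ.real (A ∩ tau C.T n (C.E k)) = μ.real (A ∩ tau C.T n (C.E1 k))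
      + μ.real (A ∩ tau C.T n (C.E2 k)) + μ.real (A ∩ tau C.T n (C.E3 k)) := by
    intro n
    rw [C.E_union k hk, tau_union, tau_union, Set.inter_union_distrib_left,
      Set.inter_union_distrib_left, measureReal_union, measureReal_union]
    · exact (tau_disjoint C.T n (C.E_disj12 k hk)).mono Set.inter_subset_right
        Set.inter_subset_right
    · exact hA.inter (tau_measurable hT _ (C.measE2 k))
    · refine Disjoint.union_left ?_ ?_
      · exact (tau_disjoint C.T n (C.E_disj13 k hk)).mono Set.inter_subset_right
          Set.inter_subset_right
      · exact (tau_disjoint C.T n (C.E_disj23 k hk)).mono Set.inter_subset_right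
          Set.inter_subset_right
    · exact hA.inter (tau_measurable hT _ (C.measE3 k))
  rw [d]
  have c : ∀ {P Q : Set X}, P =ᵐ[μ] Q → μ.real (A ∩ P) = μ.real (A ∩ Q) := fun h =>
    measureReal_congr (ae_eq_set_inter (ae_eq_refl _) h)
  congr 1
  · congr 1
    · rw [tau_add]; exact c (tau_ae hT i (e1 C hk))
    · rw [show i + (ht C k : ℤ) = (i - s k) + (ht C k + s k) by ring, tau_add]
      exact c (tau_ae hT _ (e2 C hk))
  · rw [ht_succ C hk, C.E_next k hk]
    have h3 : C.E3 k =ᵐ[μ] (tau C.T ((ht C k + s k) + ht C k) (C.E1 k) : Set X) := by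
      rw [tau_add]
      exact ((tau_ae hT _ (e1 C hk)).trans (e2 C hk)).symm
    rw [c (tau_ae hT (i + ht C k) h3), ← tau_add]
    congr 3
    push_cast; ring

end tower
end RootChacon

namespace RootChacon

section approx
variable {X : Type*} [MeasurableSpace X] {μ : Measure X} [IsProbabilityMeasure μ] {s : ℕ → ℕ}
  (C : ChaconMap μ s)

/-- the main estimate on unions of levels -/
lemma recursion {j : ℕ} (hj : 1 ≤ j) {I I' : Finset ℕ} (hI : I ⊆ Finset.range (ht C j))
    (hI' : I' ⊆ Finset.range (ht C j)) (v d : ℕ) (hs : ∀ t < d, s (j + t) = v) :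
    ∀ t ≤ d, |μ.real (lvl C j I ∩ tau C.T (ht C j) (lvl C j I'))
      - ∑ i ∈ I', μ.real (lvl C j I ∩ tau C.T (i + ht C (j + t)) (C.E (j + t)))
      - (1 / 2) * (1 - (1 / 3) ^ t) * (μ.real (lvl C j I ∩ lvl C j I')
        + μ.real (lvl C j I ∩ tau C.T (-v) (lvl C j I')))|
      ≤ (1 / 2) * (1 - (1 / 3) ^ t) * (v * μ.real (C.E j)) := by
  have hT := C.measurePreserving
  have hA := lvl_measurable C j I
  set A := lvl C j I with hAdef
  intro t
  induction t with
  | zero =>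
    intro _
    rw [inter_lvl C hj hI' hA]
    simp [add_comm]
  | succ t ih =>
    intro htd
    have ih := ih (by omega)
    have hst := hs t (by omega)
    have hk : 1 ≤ j + t := by omega
    have hE2 : C.E2 (j + t) ⊆ C.E j := by
      refine subset_trans ?_ (E_anti C hj t)
      rw [C.E_union _ hk]; exact fun x hx => Or.inl (Or.inr hx)
    have hE3 : C.E3 (j + t) ⊆ C.E j := by
      refine subset_trans ?_ (E_anti C hj t)
      rw [C.E_union _ hk]; exact fun x hx => Or.inr hx
    set θ : ℝ := (1 / 3) ^ (t + 1) with hθ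
    have hθt : (1 / 3 : ℝ) ^ t = 3 * θ := by rw [hθ, pow_succ]; ring
    have hθ0 : 0 ≤ θ := by positivity
    have q2 : μ.real (C.E2 (j + t)) = θ * μ.real (C.E j) := by
      rw [← m12 C hk, m1 C hk, E_meas C hj, hθ, pow_succ]; ring
    have q3 : μ.real (C.E3 (j + t)) = θ * μ.real (C.E j) := by
      rw [← m23 C hk, q2]
    have s2 : ∑ i ∈ I', μ.real (A ∩ tau C.T i (C.E2 (j + t))) = θ * μ.real (A ∩ lvl C j I') := by
      have := inter_lvl C hj hI' hA 0
      rw [tau_zero] at this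
      rw [this, Finset.mul_sum]
      refine Finset.sum_congr rfl fun i hi => ?_
      rw [zero_add]
      exact lvl_inter_prop C hj hI hE2 (C.measE2 _) (Finset.mem_range.1 (hI' hi)) q2
    have s3 : |∑ i ∈ I', μ.real (A ∩ tau C.T (i - v) (C.E3 (j + t)))
        - θ * μ.real (A ∩ tau C.T (-v) (lvl C j I'))| ≤ θ * (v * μ.real (C.E j)) := by
      rw [inter_lvl C hj hI' hA, Finset.mul_sum, ← Finset.sum_sub_distrib]
      refine (Finset.abs_sum_le_sum_abs _ _).trans ?_
      have hterm : ∀ i ∈ I', |μ.real (A ∩ tau C.T (i - v) (C.E3 (j + t)))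
          - θ * μ.real (A ∩ tau C.T (-v + i) (C.E j))|
          ≤ if i < v then θ * μ.real (C.E j) else 0 := by
        intro i hi
        have hi2 := Finset.mem_range.1 (hI' hi)
        split_ifs with h
        · have b1 : μ.real (A ∩ tau C.T (i - v) (C.E3 (j + t))) ≤ θ * μ.real (C.E j) := by
            rw [← q3, ← tau_measure hT (i - v) (C.measE3 (j + t))]
            exact measureReal_mono Set.inter_subset_right
          have b2 : μ.real (A ∩ tau C.T (-v + i) (C.E j)) ≤ μ.real (C.E j) := by
            rw [← tau_measure hT (-v + i) (C.measE j)]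
            exact measureReal_mono Set.inter_subset_right
          have b2' := mul_le_mul_of_nonneg_left b2 hθ0
          have b3 : 0 ≤ μ.real (A ∩ tau C.T (i - v) (C.E3 (j + t))) := measureReal_nonneg
          have b4 : 0 ≤ θ * μ.real (A ∩ tau C.T (-v + i) (C.E j)) :=
            mul_nonneg hθ0 measureReal_nonneg
          rw [abs_le]; constructor <;> linarith
        · have e : ((i : ℤ) - v) = ((i - v : ℕ) : ℤ) := by omega
          have e' : (-(v : ℤ) + i) = ((i - v : ℕ) : ℤ) := by omega
          rw [e, e', lvl_inter_prop C hj hI hE3 (C.measE3 _) (by omega) q3, sub_self, abs_zero]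
      refine (Finset.sum_le_sum hterm).trans ?_
      rw [← Finset.sum_filter, Finset.sum_const, nsmul_eq_mul]
      have hc : (I'.filter (fun i => i < v)).card ≤ v := by
        have : I'.filter (fun i => i < v) ⊆ Finset.range v := by
          intro i hi; simp at hi ⊢; exact hi.2
        simpa using Finset.card_le_card this
      have hc' : ((I'.filter (fun i => i < v)).card : ℝ) ≤ v := by exact_mod_cast hc
      have := mul_le_mul_of_nonneg_right hc'
        (mul_nonneg hθ0 (measureReal_nonneg : 0 ≤ μ.real (C.E j)))
      linarith
    have hsum : ∑ i ∈ I', μ.real (A ∩ tau C.T (i + ht C (j + t)) (C.E (j + t)))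
        = ∑ i ∈ I', μ.real (A ∩ tau C.T i (C.E2 (j + t)))
        + ∑ i ∈ I', μ.real (A ∩ tau C.T (i - v) (C.E3 (j + t)))
        + ∑ i ∈ I', μ.real (A ∩ tau C.T (i + ht C (j + (t + 1))) (C.E (j + (t + 1)))) := by
      rw [← Finset.sum_add_distrib, ← Finset.sum_add_distrib]
      refine Finset.sum_congr rfl fun i _ => ?_
      rw [one_step C hk hA, hst]
      rfl
    rw [hsum, s2, hθt] at ih
    rw [abs_le] at ih s3 ⊢
    constructor <;> nlinarith [ih.1, ih.2, s3.1, s3.2]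

lemma estimate {j : ℕ} (hj : 1 ≤ j) {I I' : Finset ℕ} (hI : I ⊆ Finset.range (ht C j))
    (hI' : I' ⊆ Finset.range (ht C j)) (v d : ℕ) (hs : ∀ t < d, s (j + t) = v) :
    |corr μ C.T (-(ht C j)) (lvl C j I) (lvl C j I')
      - (1 / 2 * corr μ C.T 0 (lvl C j I) (lvl C j I')
        + 1 / 2 * corr μ C.T v (lvl C j I) (lvl C j I'))|
      ≤ v * μ.real (C.E j) + 2 * (1 / 3) ^ d := by
  have hT := C.measurePreserving
  have h := recursion C hj hI hI' v d hs d le_rfl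
  rw [corr_neg hT _ (lvl_measurable C j I) (lvl_measurable C j I')]
  have e0 : corr μ C.T 0 (lvl C j I) (lvl C j I') = μ.real (lvl C j I ∩ lvl C j I') := by
    unfold corr; rw [tau_zero]
  have ev : corr μ C.T v (lvl C j I) (lvl C j I')
      = μ.real (lvl C j I ∩ tau C.T (-v) (lvl C j I')) := by
    rw [← corr_neg hT _ (lvl_measurable C j I) (lvl_measurable C j I'), neg_neg]
  rw [e0, ev]
  have r0 : 0 ≤ ∑ i ∈ I', μ.real (lvl C j I ∩ tau C.T (i + ht C (j + d)) (C.E (j + d))) :=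
    Finset.sum_nonneg fun _ _ => measureReal_nonneg
  have r1 : ∑ i ∈ I', μ.real (lvl C j I ∩ tau C.T (i + ht C (j + d)) (C.E (j + d)))
      ≤ (1 / 3) ^ d := by
    have : ∀ i ∈ I', μ.real (lvl C j I ∩ tau C.T (i + ht C (j + d)) (C.E (j + d)))
        ≤ (1 / 3) ^ d * μ.real (C.E j) := by
      intro i _
      rw [← E_meas C hj, ← tau_measure hT (i + ht C (j + d)) (C.measE (j + d))]
      exact measureReal_mono Set.inter_subset_right
    refine (Finset.sum_le_sum this).trans ?_
    rw [Finset.sum_const, nsmul_eq_mul]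
    have hc : (I'.card : ℝ) ≤ ht C j := by
      have := Finset.card_le_card hI'
      rw [Finset.card_range] at this
      exact_mod_cast this
    have h1 := mul_le_mul_of_nonneg_right hc (measureReal_nonneg : 0 ≤ μ.real (C.E j))
    have h2 := h1.trans (ht_mul_le C hj)
    have h3 : (0 : ℝ) ≤ (1 / 3) ^ d := by positivity
    nlinarith
  have a0 : 0 ≤ μ.real (lvl C j I ∩ lvl C j I') := measureReal_nonneg
  have a1 : μ.real (lvl C j I ∩ lvl C j I') ≤ 1 := measureReal_le_one
  have b0 : 0 ≤ μ.real (lvl C j I ∩ tau C.T (-v) (lvl C j I')) := measureReal_nonneg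
  have b1 : μ.real (lvl C j I ∩ tau C.T (-v) (lvl C j I')) ≤ 1 := measureReal_le_one
  have c0 : (0 : ℝ) ≤ (1 / 3) ^ d := by positivity
  have w0 : 0 ≤ (v : ℝ) * μ.real (C.E j) := mul_nonneg (by positivity) measureReal_nonneg
  set ε : ℝ := (1 / 3) ^ d
  set w : ℝ := (v : ℝ) * μ.real (C.E j)
  rw [abs_le] at h ⊢
  have f1 := mul_nonneg c0 a0
  have f2 := mul_nonneg c0 b0
  have f3 := mul_nonneg c0 (sub_nonneg.2 a1)
  have f4 := mul_nonneg c0 (sub_nonneg.2 b1)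
  have f5 := mul_nonneg c0 w0
  constructor <;> nlinarith [h.1, h.2]

/-- approximable by unions of levels of all high towers -/
def Appr (A : Set X) : Prop :=
  ∀ ε : ℝ, 0 < ε → ∀ᶠ j in atTop, ∃ I ⊆ Finset.range (ht C j), μ.real (A ∆ lvl C j I) < ε

lemma lvl_union (j : ℕ) (I I' : Finset ℕ) : lvl C j (I ∪ I') = lvl C j I ∪ lvl C j I' := by
  unfold lvl
  exact Finset.set_biUnion_union I I' _

lemma lvl_shift (j : ℕ) (I : Finset ℕ) (n : ℕ) :
    lvl C j (I.image (fun i => i + n)) = tau C.T n (lvl C j I) := by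
  unfold lvl
  rw [Finset.set_biUnion_finset_image, tau_eq_preimage]
  simp only [Set.preimage_iUnion, ← tau_eq_preimage, ← tau_add]
  simp only [Nat.cast_add, add_comm]

lemma lvl_ae (j : ℕ) (I : Finset ℕ) {E : Set X} (hE : C.E j =ᵐ[μ] E) :
    lvl C j I =ᵐ[μ] (⋃ i ∈ I, tau C.T (i : ℤ) E : Set X) := by
  unfold lvl
  exact Finset.eventuallyEq_iUnion I fun i _ => tau_ae C.measurePreserving _ hE

lemma lvl_refine {j : ℕ} (hj : 1 ≤ j) {I : Finset ℕ} (hI : I ⊆ Finset.range (ht C j)) :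
    ∃ I' ⊆ Finset.range (ht C (j + 1)), lvl C j I =ᵐ[μ] lvl C (j + 1) I' := by
  have hT := C.measurePreserving
  refine ⟨I ∪ I.image (fun i => i + ht C j) ∪ I.image (fun i => i + (2 * ht C j + s j)), ?_, ?_⟩
  · rw [ht_succ C hj]
    intro i hi
    simp only [Finset.mem_union, Finset.mem_image] at hi
    rw [Finset.mem_range]
    rcases hi with (hi | ⟨k, hi, rfl⟩) | ⟨k, hi, rfl⟩ <;>
      have := Finset.mem_range.1 (hI hi) <;> omega
  · rw [lvl_union, lvl_union, lvl_shift, lvl_shift]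
    have h3 : C.E3 j =ᵐ[μ] (tau C.T ((ht C j + s j) + ht C j) (C.E1 j) : Set X) := by
      rw [tau_add]
      exact ((tau_ae hT _ (e1 C hj)).trans (e2 C hj)).symm
    have hE : C.E j =ᵐ[μ] (C.E1 j ∪ tau C.T (ht C j) (C.E1 j) ∪
        tau C.T ((ht C j + s j) + ht C j) (C.E1 j) : Set X) := by
      conv_lhs => rw [C.E_union j hj]
      exact ae_eq_set_union (ae_eq_set_union (ae_eq_refl _) (e1 C hj).symm) h3
    refine (lvl_ae C j I hE).trans (Eq.eventuallyEq ?_)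
    have : ∀ n : ℤ, tau C.T n (lvl C (j + 1) I) = ⋃ i ∈ I, tau C.T (i : ℤ) (tau C.T n (C.E1 j)) := by
      intro n
      unfold lvl
      rw [C.E_next j hj, tau_eq_preimage]
      simp only [Set.preimage_iUnion, ← tau_eq_preimage, ← tau_add, add_comm]
    have h0 : lvl C (j + 1) I = ⋃ i ∈ I, tau C.T (i : ℤ) (C.E1 j) := by
      unfold lvl; rw [C.E_next j hj]
    rw [this, this, h0, show (ht C j + s j : ℤ) + ht C j = ((2 * ht C j + s j : ℕ) : ℤ) by
      push_cast; ring]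
    simp only [tau_union, Set.iUnion_union_distrib]
    rfl

lemma appr_level {j i : ℕ} (hj : 1 ≤ j) (hi : i < ht C j) :
    Appr C (tau C.T (i : ℤ) (C.E j)) := by
  have : ∀ k, j ≤ k → ∃ I ⊆ Finset.range (ht C k),
      (tau C.T (i : ℤ) (C.E j) : Set X) =ᵐ[μ] lvl C k I := by
    intro k hk
    induction k, hk using Nat.le_induction with
    | base => exact ⟨{i}, by simpa using hi, by simp [lvl]; rfl⟩
    | succ k hk ih =>
      obtain ⟨I, hI, h⟩ := ih
      obtain ⟨I', hI', h'⟩ := lvl_refine C (hj.trans hk) hI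
      exact ⟨I', hI', h.trans h'⟩
  intro ε hε
  filter_upwards [eventually_ge_atTop j] with k hk
  obtain ⟨I, hI, h⟩ := this k hk
  refine ⟨I, hI, ?_⟩
  rw [Measure.real, measure_symmDiff_eq_zero_iff.2 h]
  simpa using hε

lemma appr_of_close {A : Set X}
    (h : ∀ ε : ℝ, 0 < ε → ∃ A', Appr C A' ∧ μ.real (A ∆ A') < ε) : Appr C A := by
  intro ε hε
  obtain ⟨A', hA', hlt⟩ := h (ε / 2) (by linarith)
  filter_upwards [hA' (ε / 2) (by linarith)] with j hj
  obtain ⟨I, hI, h2⟩ := hj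
  refine ⟨I, hI, ?_⟩
  have := measureReal_symmDiff_le (μ := μ) (s := A) (t := A') (lvl C j I)
  linarith

lemma appr_union {A B : Set X} (hA : Appr C A) (hB : Appr C B) : Appr C (A ∪ B) := by
  intro ε hε
  filter_upwards [hA (ε / 2) (by linarith), hB (ε / 2) (by linarith)] with j h1 h2
  obtain ⟨I, hI, h1⟩ := h1
  obtain ⟨I', hI', h2⟩ := h2
  refine ⟨I ∪ I', Finset.union_subset hI hI', ?_⟩
  rw [lvl_union]
  have : (A ∪ B) ∆ (lvl C j I ∪ lvl C j I') ⊆ (A ∆ lvl C j I) ∪ (B ∆ lvl C j I') := by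
    intro x
    simp only [Set.mem_symmDiff, Set.mem_union]
    tauto
  have h3 := (measureReal_mono (μ := μ) this).trans (measureReal_union_le _ _)
  linarith

lemma tower_compl : Tendsto (fun j => μ.real (lvl C j (Finset.range (ht C j)))ᶜ) atTop (𝓝 0) := by
  have h1 := (ENNReal.tendsto_toReal (ENNReal.one_ne_top)).comp C.tower_full
  have h2 : Tendsto (fun j => μ.real (lvl C j (Finset.range (ht C j)))) atTop (𝓝 1) := by
    refine h1.congr fun j => ?_
    simp only [Function.comp, Measure.real, lvl, tau_nat, ht]
  have h3 : Tendsto (fun j => 1 - μ.real (lvl C j (Finset.range (ht C j)))) atTop (𝓝 (1 - 1)) :=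
    tendsto_const_nhds.sub h2
  rw [sub_self] at h3
  refine h3.congr fun j => ?_
  rw [probReal_compl_eq_one_sub (lvl_measurable C j _)]

lemma appr_compl {A : Set X} (hA : Appr C A) : Appr C Aᶜ := by
  intro ε hε
  filter_upwards [hA (ε / 2) (by linarith), (tower_compl C).eventually_lt_const (half_pos hε),
    eventually_ge_atTop 1] with j h1 h2 hj1
  obtain ⟨I, hI, h1⟩ := h1
  refine ⟨Finset.range (ht C j) \ I, Finset.sdiff_subset, ?_⟩
  have hu : lvl C j (Finset.range (ht C j) \ I) ∪ lvl C j I = lvl C j (Finset.range (ht C j)) := by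
    rw [← lvl_union, Finset.sdiff_union_of_subset hI]
  have hd : Disjoint (lvl C j (Finset.range (ht C j) \ I)) (lvl C j I) := by
    unfold lvl
    simp only [Set.disjoint_iUnion_left, Set.disjoint_iUnion_right]
    intro i' hi' i hi
    rw [Finset.mem_sdiff] at hi
    exact lev_disj C hj1 (Finset.mem_range.1 hi.1) (Finset.mem_range.1 (hI hi'))
      fun e => hi.2 (e ▸ hi')
  have hsub : Aᶜ ∆ lvl C j (Finset.range (ht C j) \ I)
      ⊆ (A ∆ lvl C j I) ∪ (lvl C j (Finset.range (ht C j)))ᶜ := by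
    rw [← hu]
    intro x
    have hx : x ∈ lvl C j (Finset.range (ht C j) \ I) → x ∉ lvl C j I :=
      fun h => Set.disjoint_left.1 hd h
    simp only [Set.mem_symmDiff, Set.mem_union, Set.mem_compl_iff]
    tauto
  have h3 := (measureReal_mono (μ := μ) hsub).trans (measureReal_union_le _ _)
  linarith

lemma appr_all {A : Set X} (hA : MeasurableSet A) : Appr C A := by
  obtain ⟨B, hB, hAB⟩ := C.generates A hA
  have hle : MeasurableSpace.generateFrom
      {S : Set X | ∃ j, 1 ≤ j ∧ ∃ i ≤ C.h j, S = (⇑C.T)^[i] '' C.E j} ≤ ‹MeasurableSpace X› := by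
    refine MeasurableSpace.generateFrom_le ?_
    rintro _ ⟨j, hj, i, hi, rfl⟩
    rw [← tau_nat]; exact tau_measurable C.measurePreserving _ (C.measE j)
  have hBA : Appr C B := by
    refine MeasurableSpace.generateFrom_induction _ (fun S _ => Appr C S) ?_ ?_ ?_ ?_ B hB
    · rintro _ ⟨j, hj, i, hi, rfl⟩ _
      rw [← tau_nat]; exact appr_level C hj (by unfold ht; omega)
    · intro ε hε
      exact Eventually.of_forall fun j => ⟨∅, by simp, by simpa [lvl] using hε⟩
    · exact fun S _ h => appr_compl C h
    · intro S hS h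
      refine appr_of_close C fun ε hε => ?_
      have hfin : ∀ n, Appr C (Set.accumulate S n) := by
        intro n
        induction n with
        | zero => simpa [Set.accumulate_def] using h 0
        | succ n ih => rw [Set.accumulate_succ]; exact appr_union C ih (h _)
      have hl := (ENNReal.tendsto_toReal (measure_ne_top μ _)).comp
        (tendsto_measure_iUnion_accumulate (μ := μ) (f := S))
      obtain ⟨n, hn⟩ := (hl.eventually_const_lt
        (show (μ (⋃ i, S i)).toReal - ε < (μ (⋃ i, S i)).toReal by linarith)).exists
      refine ⟨Set.accumulate S n, hfin n, ?_⟩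
      have hsub : Set.accumulate S n ⊆ ⋃ i, S i := Set.accumulate_subset_iUnion n
      have hm : MeasurableSet (Set.accumulate S n) :=
        MeasurableSet.biUnion (Set.to_countable _) fun i _ => hle _ (hS i)
      rw [Set.symmDiff_def, Set.sdiff_eq_empty.2 hsub, Set.union_empty, measureReal_sdiff hsub hm]
      simp only [Function.comp] at hn
      unfold Measure.real
      linarith
  refine appr_of_close C fun ε hε => ⟨B, hBA, ?_⟩
  rw [Measure.real, hAB]; simpa using hε

end approx
end RootChacon

namespace RootChacon

section final
variable {X : Type*} [MeasurableSpace X] {μ : Measure X} [IsProbabilityMeasure μ]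
  (C : ChaconMap μ (fun j => Nat.sqrt j))

lemma sq_tendsto : Tendsto (fun v : ℕ => v ^ 2) atTop atTop :=
  tendsto_pow_atTop (by norm_num)

lemma key {A B : Set X} (hA : MeasurableSet A) (hB : MeasurableSet B) :
    Tendsto (fun v : ℕ => corr μ C.T (-(ht C (v ^ 2))) A B
      - (1 / 2 * corr μ C.T 0 A B + 1 / 2 * corr μ C.T v A B)) atTop (𝓝 0) := by
  have hT := C.measurePreserving
  rw [Metric.tendsto_nhds]
  intro ε hε
  have l1 : Tendsto (fun v : ℕ => 1 / (v : ℝ) + 2 * (1 / 3 : ℝ) ^ v) atTop (𝓝 (0 + 2 * 0)) :=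
    tendsto_one_div_atTop_nhds_zero_nat.add
      ((tendsto_pow_atTop_nhds_zero_of_lt_one (by norm_num) (by norm_num)).const_mul 2)
  rw [mul_zero, add_zero] at l1
  have hε8 : 0 < ε / 8 := by linarith
  filter_upwards [l1.eventually_lt_const hε8, eventually_ge_atTop 1,
    sq_tendsto.eventually (appr_all C hA (ε / 8) hε8),
    sq_tendsto.eventually (appr_all C hB (ε / 8) hε8)] with v h1 hv hA' hB'
  obtain ⟨I, hI, hAI⟩ := hA'
  obtain ⟨I', hI', hBI⟩ := hB'
  have hj : 1 ≤ v ^ 2 := Nat.one_le_pow _ _ hv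
  have est := estimate C hj hI hI' v v (fun t htv => Nat.sqrt_add_eq' v (by omega))
  have hm : (v : ℝ) * μ.real (C.E (v ^ 2)) ≤ 1 / v := by
    have hv' : (0 : ℝ) < v := by exact_mod_cast hv
    have g1 := ht_mul_le C hj
    have g2 : ((v ^ 2 : ℕ) : ℝ) ≤ ht C (v ^ 2) := by exact_mod_cast ht_ge C hj
    have g3 := (mul_le_mul_of_nonneg_right g2
      (measureReal_nonneg : 0 ≤ μ.real (C.E (v ^ 2)))).trans g1
    rw [le_div_iff₀ hv']
    push_cast at g3
    nlinarith
  have mI := lvl_measurable C (v ^ 2) I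
  have mI' := lvl_measurable C (v ^ 2) I'
  have p1 := corr_approx hT (-(ht C (v ^ 2))) hA hB mI mI'
  have p2 := corr_approx hT 0 hA hB mI mI'
  have p3 := corr_approx hT v hA hB mI mI'
  rw [Real.dist_eq, sub_zero]
  rw [abs_le] at est p1 p2 p3
  rw [abs_lt]
  constructor <;> linarith [est.1, est.2, p1.1, p1.2, p2.1, p2.2, p3.1, p3.2]

/-- index set: pairs of measurable sets -/
abbrev Idx (X : Type*) [MeasurableSpace X] : Type _ :=
  {A : Set X // MeasurableSet A} × {A : Set X // MeasurableSet A}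

/-- correlations as points of a product space -/
noncomputable def UU (μ : Measure X) (T : X ≃ᵐ X) (n : ℤ) : Idx X → ℝ :=
  fun i => corr μ T n i.1.1 i.2.1

lemma K1 (c : ℤ) : Tendsto (fun v : ℕ => UU μ C.T (c - (ht C (v ^ 2) : ℕ))
    - ((1 / 2 : ℝ) • UU μ C.T c + (1 / 2 : ℝ) • UU μ C.T (c + v))) atTop (𝓝 0) := by
  rw [tendsto_pi_nhds]
  rintro ⟨⟨A, hA⟩, ⟨B, hB⟩⟩
  refine (key C (tau_measurable C.measurePreserving c hA) hB).congr fun v => ?_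
  simp only [UU, Pi.sub_apply, Pi.add_apply, Pi.smul_apply, smul_eq_mul, ← corr_add]
  rw [show -(ht C (v ^ 2) : ℤ) + c = c - ht C (v ^ 2) by ring, zero_add, add_comm (v : ℤ) c]

lemma K2 (c : ℤ) : Tendsto (fun v : ℕ => UU μ C.T (c + (ht C (v ^ 2) : ℕ))
    - ((1 / 2 : ℝ) • UU μ C.T c + (1 / 2 : ℝ) • UU μ C.T (c - v))) atTop (𝓝 0) := by
  rw [tendsto_pi_nhds]
  rintro ⟨⟨A, hA⟩, ⟨B, hB⟩⟩
  have hT := C.measurePreserving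
  refine ((tendsto_pi_nhds.1 (K1 C (-c))) (⟨B, hB⟩, ⟨A, hA⟩)).congr fun v => ?_
  simp only [UU, Pi.sub_apply, Pi.add_apply, Pi.smul_apply, smul_eq_mul]
  rw [corr_symm hT (c + ht C (v ^ 2)) hA hB, corr_symm hT c hA hB, corr_symm hT (c - v) hA hB]
  rw [show -(c + (ht C (v ^ 2) : ℤ)) = -c - ht C (v ^ 2) by ring,
    show -(c - (v : ℤ)) = -c + v by ring]

end final
end RootChacon

/-- the root Chacon map possesses all polynomial weak limits of its
powers. -/
theorem rootChacon_all_polynomial_weak_limits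
    {X : Type*} [MeasurableSpace X] (μ : Measure X) [IsProbabilityMeasure μ]
    (C : ChaconMap μ (fun j => Nat.sqrt j)) :
    ∀ (m : ℕ) (p : Fin (m + 1) → ℕ), StrictMono p →
      ∀ a : Fin (m + 1) → ℝ, (∀ i, 0 ≤ a i) → (∑ i, a i) = 1 →
        ∃ q : ℕ → ℕ, Tendsto q atTop atTop ∧
          ∀ A B : Set X, MeasurableSet A → MeasurableSet B →
            Tendsto (fun k => (μ ((⇑C.T)^[q k] '' A ∩ B)).toReal) atTop
              (𝓝 (∑ i, a i * (μ ((⇑C.T)^[p i] '' A ∩ B)).toReal)) := by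
  intro m p _ a ha hsum
  open RootChacon in
  have hT := C.measurePreserving
  have hH : Tendsto (fun v : ℕ => ht C (v ^ 2)) atTop atTop := by
    refine tendsto_atTop_mono' atTop ?_ sq_tendsto
    filter_upwards [eventually_ge_atTop 1] with v hv
    exact ht_ge C (Nat.one_le_pow _ _ hv)
  obtain ⟨hconv, hU⟩ := abstract_main (UU μ C.T) (fun n i => corr_mem C.T n _ _) _ hH
    (K1 C) (K2 C)
  have hmem : ∑ i, a i • UU μ C.T (p i) ∈ Lim (UU μ C.T) :=
    hconv.sum_mem (fun i _ => ha i) hsum fun i _ => hU _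
  -- restrict to countably many pairs
  let D : (ℕ × Finset ℕ) × (ℕ × Finset ℕ) → Idx X := fun z =>
    (⟨lvl C z.1.1 z.1.2, lvl_measurable C _ _⟩, ⟨lvl C z.2.1 z.2.2, lvl_measurable C _ _⟩)
  have hcont : Continuous (fun (f : Idx X → ℝ) z => f (D z)) := by fun_prop
  have hcl : MapClusterPt (fun z => (∑ i, a i • UU μ C.T (p i)) (D z)) atTop
      (fun (n : ℕ) z => UU μ C.T n (D z)) :=
    MapClusterPt.continuousAt_comp (f := fun (f : Idx X → ℝ) z => f (D z)) hcont.continuousAt hmem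
  obtain ⟨q, hq, hlim⟩ := hcl.tendsto_subseq
  refine ⟨q, hq.tendsto_atTop, fun A B hA hB => ?_⟩
  have goal' : Tendsto (fun k => corr μ C.T (q k) A B) atTop
      (𝓝 (∑ i, a i * corr μ C.T (p i) A B)) := by
    rw [Metric.tendsto_nhds]
    intro ε hε
    have hε8 : 0 < ε / 8 := by linarith
    obtain ⟨j, ⟨I, hI, hAI⟩, ⟨I', hI', hBI⟩⟩ :=
      ((appr_all C hA (ε / 8) hε8).and (appr_all C hB (ε / 8) hε8)).exists
    have mI := lvl_measurable C j I
    have mI' := lvl_measurable C j I'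
    have hl := (tendsto_pi_nhds.1 hlim) ((j, I), (j, I'))
    rw [Metric.tendsto_nhds] at hl
    filter_upwards [hl (ε / 8) hε8] with k hk
    simp only [Function.comp, D, UU, Finset.sum_apply, Pi.smul_apply, smul_eq_mul] at hk
    have p1 := corr_approx hT (q k) hA hB mI mI'
    have p2 : |∑ i, a i * corr μ C.T (p i) A B
        - ∑ i, a i * corr μ C.T (p i) (lvl C j I) (lvl C j I')| ≤ ε / 4 := by
      rw [← Finset.sum_sub_distrib]
      refine (Finset.abs_sum_le_sum_abs _ _).trans ?_
      have : ∀ i ∈ Finset.univ, |a i * corr μ C.T (p i) A B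
          - a i * corr μ C.T (p i) (lvl C j I) (lvl C j I')| ≤ a i * (ε / 4) := by
        intro i _
        rw [← mul_sub, abs_mul, abs_of_nonneg (ha i)]
        refine mul_le_mul_of_nonneg_left ?_ (ha i)
        have := corr_approx hT (p i) hA hB mI mI'
        linarith
      refine (Finset.sum_le_sum this).trans ?_
      rw [← Finset.sum_mul, hsum, one_mul]
    rw [Real.dist_eq] at hk ⊢
    rw [abs_lt] at hk ⊢
    rw [abs_le] at p1 p2
    constructor <;> linarith [hk.1, hk.2, p1.1, p1.2, p2.1, p2.2]
  simpa only [corr, tau_nat, Measure.real] using goal'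
end

section
/- The root Chacon map T is weakly mixing: the product transformation T × T is ergodic on (X × X, μ ⊗ μ). -/
open MeasureTheory Filter Topology
open scoped symmDiff

namespace ChaconMap

variable {X : Type*} [MeasurableSpace X] {μ : Measure X} {s : ℕ → ℕ}

lemma iter_emb (C : ChaconMap μ s) (i : ℕ) : MeasurableEmbedding (⇑C.T)^[i] := by
  induction i with
  | zero => exact MeasurableEmbedding.id
  | succ n ih => rw [Function.iterate_succ]; exact ih.comp C.T.measurableEmbedding

lemma measure_img (C : ChaconMap μ s) (i : ℕ) (S : Set X) : μ ((⇑C.T)^[i] '' S) = μ S := by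
  rw [← (C.measurePreserving.iterate i).measure_preimage_emb (C.iter_emb i),
    Set.preimage_image_eq _ (C.iter_emb i).injective]

lemma img_ae (C : ChaconMap μ s) (i : ℕ) {S S' : Set X} (h : μ (S ∆ S') = 0) :
    ((⇑C.T)^[i] '' S : Set X) =ᵐ[μ] ((⇑C.T)^[i] '' S' : Set X) := by
  rw [← measure_symmDiff_eq_zero_iff, ← Set.image_symmDiff (C.iter_emb i).injective, measure_img, h]

lemma img_inter (C : ChaconMap μ s) (i : ℕ) (S B : Set X) :
    μ ((⇑C.T)^[i] '' S ∩ B) = μ (S ∩ (⇑C.T)^[i] ⁻¹' B) := by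
  rw [← Set.image_inter_preimage, measure_img]

lemma img_img (C : ChaconMap μ s) (i k : ℕ) (S : Set X) :
    (⇑C.T)^[i] '' ((⇑C.T)^[k] '' S) = (⇑C.T)^[i + k] '' S := by
  rw [Function.iterate_add, Set.image_comp]

/-- level `i` of tower `j` -/
def Lv (C : ChaconMap μ s) (j i : ℕ) : Set X := (⇑C.T)^[i] '' C.E j

lemma measLv (C : ChaconMap μ s) (j i : ℕ) : MeasurableSet (C.Lv j i) :=
  (C.iter_emb i).measurableSet_image.2 (C.measE j)

lemma E1_sub (C : ChaconMap μ s) {j : ℕ} (hj : 1 ≤ j) : C.E1 j ⊆ C.E j := by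
  rw [C.E_union j hj]; intro x hx; exact Or.inl (Or.inl hx)
lemma E2_sub (C : ChaconMap μ s) {j : ℕ} (hj : 1 ≤ j) : C.E2 j ⊆ C.E j := by
  rw [C.E_union j hj]; intro x hx; exact Or.inl (Or.inr hx)
lemma E3_sub (C : ChaconMap μ s) {j : ℕ} (hj : 1 ≤ j) : C.E3 j ⊆ C.E j := by
  rw [C.E_union j hj]; intro x hx; exact Or.inr hx

lemma Lv_succ1 (C : ChaconMap μ s) {j : ℕ} (hj : 1 ≤ j) (i : ℕ) :
    C.Lv (j + 1) i = (⇑C.T)^[i] '' C.E1 j := by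
  rw [Lv, C.E_next j hj]

lemma Lv_succ2 (C : ChaconMap μ s) {j : ℕ} (hj : 1 ≤ j) (i : ℕ) :
    C.Lv (j + 1) (i + (C.h j + 1)) =ᵐ[μ] ((⇑C.T)^[i] '' C.E2 j : Set X) := by
  rw [Lv_succ1 C hj, ← img_img]
  exact C.img_ae i (C.stack1 j hj)

lemma Lv_succ3 (C : ChaconMap μ s) {j : ℕ} (hj : 1 ≤ j) (i : ℕ) :
    C.Lv (j + 1) (i + (C.h j + 1 + s j) + (C.h j + 1)) =ᵐ[μ] ((⇑C.T)^[i] '' C.E3 j : Set X) := by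
  refine (C.Lv_succ2 hj _).trans ?_
  rw [← img_img]
  exact C.img_ae i (C.stack2 j hj)

/-- each level of tower `j+1` is in a level of tower `j` or is disjoint from tower `j` -/
lemma step (C : ChaconMap μ s) {j : ℕ} (hj : 1 ≤ j) (i' : ℕ) (hi' : i' ≤ C.h (j + 1)) :
    (∃ i ≤ C.h j, C.Lv (j + 1) i' ≤ᵐ[μ] C.Lv j i) ∨
      (∀ i ≤ C.h j, ∀ᵐ x ∂μ, x ∈ C.Lv (j + 1) i' → x ∉ C.Lv j i) := by
  have hs := C.h_succ j hj
  by_cases h1 : i' ≤ C.h j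
  · left
    refine ⟨i', h1, Filter.Eventually.of_forall ?_⟩
    rw [Lv_succ1 C hj]
    exact Set.image_mono (C.E1_sub hj)
  by_cases h2 : i' ≤ 2 * C.h j + 1
  · left
    obtain ⟨i, rfl⟩ : ∃ i, i' = i + (C.h j + 1) := ⟨i' - (C.h j + 1), by omega⟩
    refine ⟨i, by omega, (C.Lv_succ2 hj i).le.trans (Filter.Eventually.of_forall ?_)⟩
    exact Set.image_mono (C.E2_sub hj)
  by_cases h3 : i' ≤ 2 * C.h j + 1 + s j
  · right
    intro i hi
    obtain ⟨r, rfl⟩ : ∃ r, i' = C.h j + r + (C.h j + 1) := ⟨i' - (C.h j + 1) - C.h j, by omega⟩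
    have hd := C.spacer_disjoint j hj r (by omega) (by omega) i hi
    filter_upwards [(C.Lv_succ2 hj (C.h j + r)).mem_iff] with x hx hx1 hx2
    exact Set.disjoint_left.1 hd (hx.1 hx1) hx2
  · left
    obtain ⟨i, rfl⟩ : ∃ i, i' = i + (C.h j + 1 + s j) + (C.h j + 1) :=
      ⟨i' - (C.h j + 1) - (C.h j + 1 + s j), by omega⟩
    refine ⟨i, by omega, (C.Lv_succ3 hj i).le.trans (Filter.Eventually.of_forall ?_)⟩
    exact Set.image_mono (C.E3_sub hj)

lemma cover_step (C : ChaconMap μ s) {j : ℕ} (hj : 1 ≤ j) (i : ℕ) (hi : i ≤ C.h j) :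
    ∀ᵐ x ∂μ, x ∈ C.Lv j i → ∃ i' ≤ C.h (j + 1), x ∈ C.Lv (j + 1) i' := by
  have hs := C.h_succ j hj
  filter_upwards [(C.Lv_succ2 hj i).mem_iff, (C.Lv_succ3 hj i).mem_iff] with x h2 h3 hx
  rw [Lv, C.E_union j hj, Set.image_union, Set.image_union] at hx
  rcases hx with (hx | hx) | hx
  · exact ⟨i, by omega, by rw [Lv_succ1 C hj]; exact hx⟩
  · exact ⟨_, by omega, h2.2 hx⟩
  · exact ⟨_, by omega, h3.2 hx⟩

lemma cover (C : ChaconMap μ s) {k j : ℕ} (hk : 1 ≤ k) (hkj : k ≤ j) (i : ℕ) (hi : i ≤ C.h k) :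
    ∀ᵐ x ∂μ, x ∈ C.Lv k i → ∃ i' ≤ C.h j, x ∈ C.Lv j i' := by
  induction j, hkj using Nat.le_induction with
  | base => exact Filter.Eventually.of_forall fun x hx => ⟨i, hi, hx⟩
  | succ j hkj ih =>
    have : ∀ᵐ x ∂μ, ∀ i' : ℕ, i' ≤ C.h j → x ∈ C.Lv j i' →
        ∃ i'' ≤ C.h (j + 1), x ∈ C.Lv (j + 1) i'' := by
      rw [ae_all_iff]; intro i'
      by_cases h : i' ≤ C.h j
      · filter_upwards [C.cover_step (hk.trans hkj) i' h] with x hx _ using hx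
      · exact Filter.Eventually.of_forall fun x h' => absurd h' h
    filter_upwards [ih, this] with x h1 h2 hx
    obtain ⟨i', hi', hx'⟩ := h1 hx
    exact h2 i' hi' hx'

lemma nested (C : ChaconMap μ s) {k j : ℕ} (hk : 1 ≤ k) (hkj : k ≤ j) (i : ℕ) (hi : i ≤ C.h k) :
    ∀ i' ≤ C.h j, C.Lv j i' ≤ᵐ[μ] C.Lv k i ∨ ∀ᵐ x ∂μ, x ∈ C.Lv j i' → x ∉ C.Lv k i := by
  induction j, hkj using Nat.le_induction with
  | base =>
    intro i' hi'
    by_cases h : i' = i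
    · subst h; exact Or.inl (Filter.EventuallyLE.refl _ _)
    · right
      exact Filter.Eventually.of_forall fun x hx hx' =>
        Set.disjoint_left.1 (C.tower_disjoint k hk i' hi' i hi h) hx hx'
  | succ j hkj ih =>
    intro i' hi'
    rcases C.step (hk.trans hkj) i' hi' with ⟨m, hm, hle⟩ | hd
    · rcases ih m hm with h | h
      · exact Or.inl (hle.trans h)
      · right
        filter_upwards [h, hle] with x h1 h2 hx using h1 (h2 hx)
    · right
      have : ∀ᵐ x ∂μ, ∀ i : ℕ, i ≤ C.h j → x ∈ C.Lv (j + 1) i' → x ∉ C.Lv j i := by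
        rw [ae_all_iff]; intro i
        by_cases h : i ≤ C.h j
        · filter_upwards [hd i h] with x hx _ using hx
        · exact Filter.Eventually.of_forall fun x h' => absurd h' h
      filter_upwards [this, C.cover hk hkj i hi] with x h1 h2 hx hx'
      obtain ⟨m, hm, hxm⟩ := h2 hx'
      exact h1 m hm hx hxm

open scoped ENNReal

/-- how badly `A` is approximated by unions of levels of tower `j` -/
noncomputable def V (C : ChaconMap μ s) (j : ℕ) (A : Set X) : ℝ≥0∞ :=
  ∑ i ∈ Finset.range (C.h j + 1), min (μ (C.Lv j i ∩ A)) (μ (C.Lv j i \ A))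

lemma V_compl (C : ChaconMap μ s) (j : ℕ) (A : Set X) : C.V j Aᶜ = C.V j A := by
  unfold V
  refine Finset.sum_congr rfl fun i _ => ?_
  rw [min_comm, Set.sdiff_compl, Set.sdiff_eq]

lemma V_union (C : ChaconMap μ s) (j : ℕ) (A B : Set X) : C.V j (A ∪ B) ≤ C.V j A + C.V j B := by
  unfold V
  rw [← Finset.sum_add_distrib]
  refine Finset.sum_le_sum fun i _ => ?_
  rcases min_choice (μ (C.Lv j i ∩ A)) (μ (C.Lv j i \ A)) with h | h
  · rcases min_choice (μ (C.Lv j i ∩ B)) (μ (C.Lv j i \ B)) with h' | h'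
    · rw [h, h', Set.inter_union_distrib_left]
      exact (min_le_left _ _).trans (measure_union_le _ _)
    · rw [h']
      refine (min_le_right _ _).trans (le_trans (measure_mono ?_) le_add_self)
      exact Set.sdiff_subset_sdiff_right Set.subset_union_right
  · rw [h]
    refine (min_le_right _ _).trans (le_trans (measure_mono ?_) le_self_add)
    exact Set.sdiff_subset_sdiff_right Set.subset_union_left

lemma sum_Lv (C : ChaconMap μ s) {j : ℕ} (hj : 1 ≤ j) {S : Set X}
    (hS : MeasurableSet S) :
    ∑ i ∈ Finset.range (C.h j + 1), μ (C.Lv j i ∩ S) ≤ μ S := by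
  rw [← measure_biUnion_finset₀]
  · exact measure_mono (by intro x; simp)
  · intro i hi i' hi' hne
    simp only [Finset.coe_range, Set.mem_Iio] at hi hi'
    exact ((C.tower_disjoint j hj i (by omega) i' (by omega) hne).mono
      Set.inter_subset_left Set.inter_subset_left).aedisjoint
  · exact fun i _ => ((C.measLv j i).inter hS).nullMeasurableSet

lemma V_le (C : ChaconMap μ s) {j : ℕ} (hj : 1 ≤ j) {A B : Set X} (hA : MeasurableSet A)
    (hB : MeasurableSet B) : C.V j A ≤ C.V j B + μ (A ∆ B) := by
  refine le_trans ?_ (add_le_add_right (C.sum_Lv hj (hA.symmDiff hB)) _)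
  unfold V
  rw [← Finset.sum_add_distrib]
  refine Finset.sum_le_sum fun i _ => ?_
  rw [min_add]
  refine min_le_min (le_trans (measure_mono ?_) (measure_union_le _ _))
    (le_trans (measure_mono ?_) (measure_union_le _ _))
  · rintro x ⟨h1, h2⟩
    by_cases hb : x ∈ B
    · exact Or.inl ⟨h1, hb⟩
    · exact Or.inr ⟨h1, Or.inl ⟨h2, hb⟩⟩
  · rintro x ⟨h1, h2⟩
    by_cases hb : x ∈ B
    · exact Or.inr ⟨h1, Or.inr ⟨hb, h2⟩⟩
    · exact Or.inl ⟨h1, hb⟩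

lemma V_le_one [IsProbabilityMeasure μ] (C : ChaconMap μ s) {j : ℕ} (hj : 1 ≤ j) {A : Set X}
    (hA : MeasurableSet A) : C.V j A ≤ 1 :=
  (Finset.sum_le_sum fun _ _ => min_le_left _ _).trans ((C.sum_Lv hj hA).trans prob_le_one)

lemma V_level (C : ChaconMap μ s) {k j : ℕ} (hk : 1 ≤ k) (hkj : k ≤ j) {i : ℕ} (hi : i ≤ C.h k) :
    C.V j (C.Lv k i) = 0 := by
  unfold V
  refine Finset.sum_eq_zero fun i' hi' => ?_
  rw [Finset.mem_range] at hi'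
  rcases C.nested hk hkj i hi i' (by omega) with h | h
  · exact le_antisymm ((min_le_right _ _).trans (ae_le_set.1 h).le) bot_le
  · refine le_antisymm ((min_le_left _ _).trans (le_of_eq ?_)) bot_le
    refine measure_mono_null (fun x hx => ?_) h
    exact fun hc => hc hx.1 hx.2

lemma V_tendsto_gen [IsProbabilityMeasure μ] (C : ChaconMap μ s) {A : Set X}
    (hA : MeasurableSet[MeasurableSpace.generateFrom
      {S : Set X | ∃ j, 1 ≤ j ∧ ∃ i ≤ C.h j, S = (⇑C.T)^[i] '' C.E j}] A) :
    MeasurableSet A ∧ Tendsto (fun j => C.V j A) atTop (𝓝 0) := by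
  induction A, hA using MeasurableSpace.generateFrom_induction with
  | hC A hA _ =>
    obtain ⟨k, hk, i, hi, rfl⟩ := hA
    refine ⟨C.measLv k i, ?_⟩
    refine tendsto_const_nhds.congr' ?_
    filter_upwards [eventually_ge_atTop k] with j hj
    exact (C.V_level hk hj hi).symm
  | empty =>
    refine ⟨MeasurableSet.empty, ?_⟩
    simp [V]
  | compl A _ ih =>
    refine ⟨ih.1.compl, ?_⟩
    simpa only [V_compl] using ih.2
  | iUnion f _ ih =>
    have hm : MeasurableSet (⋃ n, f n) := MeasurableSet.iUnion fun n => (ih n).1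
    refine ⟨hm, ?_⟩
    have hacc : ∀ N : ℕ, MeasurableSet (Set.accumulate f N) ∧
        Tendsto (fun j => C.V j (Set.accumulate f N)) atTop (𝓝 0) := by
      intro N
      induction N with
      | zero => simpa using ih 0
      | succ N ihN =>
        rw [Set.accumulate_succ]
        refine ⟨ihN.1.union (ih _).1, ?_⟩
        have h := ihN.2.add (ih (N + 1)).2
        rw [add_zero] at h
        exact tendsto_of_tendsto_of_tendsto_of_le_of_le tendsto_const_nhds h
          (fun _ => bot_le) (fun j => C.V_union j _ _)
    have hlim : Tendsto (fun N => μ ((⋃ n, f n) \ Set.accumulate f N)) atTop (𝓝 0) := by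
      have h := tendsto_measure_iInter_atTop (μ := μ)
        (s := fun N => (⋃ n, f n) \ Set.accumulate f N)
        (fun N => (hm.diff (hacc N).1).nullMeasurableSet)
        (fun a b hab => Set.sdiff_subset_sdiff_right (Set.monotone_accumulate hab))
        ⟨0, measure_ne_top _ _⟩
      rwa [← Set.sdiff_iUnion, Set.iUnion_accumulate, Set.sdiff_self, measure_empty] at h
    rw [ENNReal.tendsto_nhds_zero]
    intro ε hε
    have hε2 : 0 < ε / 2 := ENNReal.half_pos hε.ne'
    obtain ⟨N, hN⟩ := ((ENNReal.tendsto_nhds_zero.1 hlim) (ε / 2) hε2).exists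
    filter_upwards [ENNReal.tendsto_nhds_zero.1 (hacc N).2 (ε / 2) hε2, eventually_ge_atTop 1]
      with j hj h1
    calc C.V j (⋃ n, f n) ≤ C.V j (Set.accumulate f N) + μ ((⋃ n, f n) ∆ Set.accumulate f N) :=
          C.V_le h1 hm (hacc N).1
      _ ≤ ε / 2 + ε / 2 := by
          refine add_le_add hj ?_
          rw [Set.symmDiff_def, Set.sdiff_eq_empty.2 (Set.accumulate_subset_iUnion N),
            Set.union_empty]
          exact hN
      _ = ε := ENNReal.add_halves ε

lemma V_tendsto [IsProbabilityMeasure μ] (C : ChaconMap μ s) {A : Set X} (hA : MeasurableSet A) :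
    Tendsto (fun j => C.V j A) atTop (𝓝 0) := by
  obtain ⟨B, hB, hAB⟩ := C.generates A hA
  obtain ⟨hBm, hB'⟩ := C.V_tendsto_gen hB
  refine tendsto_of_tendsto_of_tendsto_of_le_of_le' tendsto_const_nhds hB'
    (Filter.Eventually.of_forall fun _ => bot_le) ?_
  filter_upwards [eventually_ge_atTop 1] with j hj
  simpa [hAB] using C.V_le hj hA hBm

/-- the union of the levels of tower `j` -/
def tw (C : ChaconMap μ s) (j : ℕ) : Set X := ⋃ i ∈ Finset.range (C.h j + 1), C.Lv j i

lemma meas_tw (C : ChaconMap μ s) (j : ℕ) : MeasurableSet (C.tw j) :=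
  Finset.measurableSet_biUnion _ fun i _ => C.measLv j i

lemma tw_tendsto [IsProbabilityMeasure μ] (C : ChaconMap μ s) :
    Tendsto (fun j => μ (C.tw j)ᶜ) atTop (𝓝 0) := by
  have h : ∀ j, μ (C.tw j)ᶜ = 1 - μ (C.tw j) := fun j => prob_compl_eq_one_sub (C.meas_tw j)
  simp only [h]
  have := ENNReal.Tendsto.sub (tendsto_const_nhds (x := (1 : ℝ≥0∞)) (f := atTop)) C.tower_full
    (Or.inl ENNReal.one_ne_top)
  simpa [tw, Lv] using this

lemma ergodic_T [IsProbabilityMeasure μ] (C : ChaconMap μ s) {B : Set X} (hB : MeasurableSet B)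
    (hinv : C.T ⁻¹' B =ᵐ[μ] B) : μ B = 0 ∨ μ Bᶜ = 0 := by
  have hit : ∀ i, ((⇑C.T)^[i] ⁻¹' B : Set X) =ᵐ[μ] B := fun i =>
    C.measurePreserving.quasiMeasurePreserving.preimage_iterate_ae_eq i hinv
  have key : ∀ j, min (μ B) (μ Bᶜ) ≤ C.V j B + μ (C.tw j)ᶜ := by
    intro j
    have h1 : ∀ i, μ (C.Lv j i ∩ B) = μ (C.E j ∩ B) := fun i => by
      rw [Lv, img_inter]
      exact measure_congr ((ae_eq_refl _).inter (hit i))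
    have h2 : ∀ i, μ (C.Lv j i \ B) = μ (C.E j \ B) := fun i => by
      rw [Lv, Set.sdiff_eq, img_inter, Set.preimage_compl]
      exact measure_congr ((ae_eq_refl _).inter (hit i).compl)
    have hV : C.V j B = (C.h j + 1 : ℕ) * min (μ (C.E j ∩ B)) (μ (C.E j \ B)) := by
      simp [V, h1, h2]
    have hdec : ∀ D : Set X, μ D ≤ ∑ i ∈ Finset.range (C.h j + 1), μ (C.Lv j i ∩ D)
        + μ (C.tw j)ᶜ := by
      intro D
      calc μ D ≤ μ ((⋃ i ∈ Finset.range (C.h j + 1), C.Lv j i ∩ D) ∪ (C.tw j)ᶜ) := by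
            refine measure_mono fun x hx => ?_
            by_cases h : x ∈ C.tw j
            · left
              simp only [tw, Set.mem_iUnion] at h ⊢
              obtain ⟨i, hi, hxi⟩ := h
              exact ⟨i, hi, hxi, hx⟩
            · exact Or.inr h
        _ ≤ _ := (measure_union_le _ _).trans
            (add_le_add_left (measure_biUnion_finset_le _ _) _)
    rcases min_choice (μ (C.E j ∩ B)) (μ (C.E j \ B)) with h | h
    · rw [hV, h]
      refine (min_le_left _ _).trans ((hdec B).trans ?_)
      simp [h1]
    · rw [hV, h]
      refine (min_le_right _ _).trans ((hdec Bᶜ).trans ?_)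
      simp only [← Set.sdiff_eq, h2]
      simp
  have hl := (C.V_tendsto hB).add C.tw_tendsto
  rw [add_zero] at hl
  have h0 : min (μ B) (μ Bᶜ) ≤ 0 := ge_of_tendsto' hl key
  rcases min_choice (μ B) (μ Bᶜ) with h | h
  · left; rw [h] at h0; exact le_antisymm h0 bot_le
  · right; rw [h] at h0; exact le_antisymm h0 bot_le

lemma sum_shift_le (C : ChaconMap μ s) {j n : ℕ} {c B : Set X} (hc : c ⊆ C.E j)
    (hn : ((⇑C.T)^[n] '' c : Set X) ≤ᵐ[μ] C.E j) :
    ∑ i ∈ Finset.range (C.h j + 1), μ ((B ∆ ((⇑C.T)^[n] ⁻¹' B)) ∩ (⇑C.T)^[i] '' c)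
      ≤ 2 * C.V j B := by
  unfold V
  rw [Finset.mul_sum]
  refine Finset.sum_le_sum fun i _ => ?_
  have hle : ((⇑C.T)^[n] '' ((⇑C.T)^[i] '' c) : Set X) ≤ᵐ[μ] C.Lv j i := by
    rw [img_img, add_comm, ← img_img, Lv, ae_le_set,
      ← Set.image_sdiff (C.iter_emb i).injective, measure_img]
    exact ae_le_set.1 hn
  have aux : ∀ D : Set X, B ∆ ((⇑C.T)^[n] ⁻¹' B) ⊆ D ∪ (⇑C.T)^[n] ⁻¹' D →
      μ ((B ∆ ((⇑C.T)^[n] ⁻¹' B)) ∩ (⇑C.T)^[i] '' c) ≤ 2 * μ (C.Lv j i ∩ D) := by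
    intro D hD
    have h1 : (B ∆ ((⇑C.T)^[n] ⁻¹' B)) ∩ (⇑C.T)^[i] '' c ⊆
        (C.Lv j i ∩ D) ∪ ((⇑C.T)^[i] '' c ∩ (⇑C.T)^[n] ⁻¹' D) := by
      rintro x ⟨hx, hxc⟩
      rcases hD hx with h | h
      · exact Or.inl ⟨Set.image_mono hc hxc, h⟩
      · exact Or.inr ⟨hxc, h⟩
    refine (measure_mono h1).trans ((measure_union_le _ _).trans ?_)
    rw [two_mul, ← img_inter]
    refine add_le_add le_rfl (measure_mono_ae ?_)
    filter_upwards [hle] with x hx h using ⟨hx h.1, h.2⟩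
  rcases min_choice (μ (C.Lv j i ∩ B)) (μ (C.Lv j i \ B)) with h | h
  · rw [h]
    refine aux B ?_
    rintro x (hx | hx)
    · exact Or.inl hx.1
    · exact Or.inr hx.1
  · rw [h, Set.sdiff_eq]
    refine aux Bᶜ ?_
    rintro x (hx | hx)
    · exact Or.inr hx.2
    · exact Or.inl hx.2

lemma mp_prod [IsProbabilityMeasure μ] (C : ChaconMap μ s) :
    MeasurePreserving (fun x : X × X => (C.T x.1, C.T x.2)) (μ.prod μ) (μ.prod μ) :=
  C.measurePreserving.prod C.measurePreserving

lemma mp_left [IsProbabilityMeasure μ] (C : ChaconMap μ s) (n : ℕ) :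
    MeasurePreserving (fun x : X × X => ((⇑C.T)^[n] x.1, x.2)) (μ.prod μ) (μ.prod μ) :=
  (C.measurePreserving.iterate n).prod (MeasurePreserving.id μ)

lemma rho_img [IsProbabilityMeasure μ] (C : ChaconMap μ s) {W : Set (X × X)}
    (hW : MeasurableSet W) (hinv : (fun x : X × X => (C.T x.1, C.T x.2)) ⁻¹' W = W)
    {c : Set X} (hc : MeasurableSet c) (i : ℕ) :
    (μ.prod μ) (W ∩ ((⇑C.T)^[i] '' c) ×ˢ Set.univ) = (μ.prod μ) (W ∩ c ×ˢ Set.univ) := by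
  induction i generalizing c with
  | zero => simp
  | succ i ih =>
    have hc' : MeasurableSet (C.T '' c) := C.T.measurableEmbedding.measurableSet_image.2 hc
    rw [Function.iterate_succ, Set.image_comp, ih hc',
      ← C.mp_prod.measure_preimage (hW.inter (hc'.prod MeasurableSet.univ)).nullMeasurableSet,
      Set.preimage_inter, hinv]
    congr 2
    ext ⟨x, y⟩
    simp

/-- difference of `A` and its shift in the first coordinate -/
def W (C : ChaconMap μ s) (A : Set (X × X)) (n : ℕ) : Set (X × X) :=
  A ∆ ((fun x : X × X => ((⇑C.T)^[n] x.1, x.2)) ⁻¹' A)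

lemma meas_W [IsProbabilityMeasure μ] (C : ChaconMap μ s) {A : Set (X × X)} (hA : MeasurableSet A)
    (n : ℕ) : MeasurableSet (C.W A n) :=
  hA.symmDiff ((C.mp_left n).measurable hA)

lemma W_inv (C : ChaconMap μ s) {A : Set (X × X)}
    (hinv : (fun x : X × X => (C.T x.1, C.T x.2)) ⁻¹' A = A) (n : ℕ) :
    (fun x : X × X => (C.T x.1, C.T x.2)) ⁻¹' (C.W A n) = C.W A n := by
  have h : ∀ x y, (C.T x, C.T y) ∈ A ↔ (x, y) ∈ A := fun x y => by
    conv_rhs => rw [← hinv]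
    rfl
  ext ⟨x, y⟩
  simp only [W, Set.mem_preimage, Set.mem_symmDiff, h, ← Function.iterate_succ_apply,
    Function.iterate_succ_apply' (⇑C.T) n x]

lemma W_bound [IsProbabilityMeasure μ] (C : ChaconMap μ s) {A : Set (X × X)}
    (hA : MeasurableSet A) (hinv : (fun x : X × X => (C.T x.1, C.T x.2)) ⁻¹' A = A)
    {j n : ℕ} {c : Set X} (hcm : MeasurableSet c) (hc : c ⊆ C.E j)
    (hn : ((⇑C.T)^[n] '' c : Set X) ≤ᵐ[μ] C.E j)
    (h3 : (μ.prod μ) (C.W A n ∩ C.E j ×ˢ Set.univ) ≤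
      3 * (μ.prod μ) (C.W A n ∩ c ×ˢ Set.univ)) :
    (μ.prod μ) (C.W A n) ≤
      3 * (2 * ∫⁻ y, C.V j ((fun x => (x, y)) ⁻¹' A) ∂μ) + μ (C.tw j)ᶜ := by
  have hWm := C.meas_W hA n
  have hWi := C.W_inv hinv n
  have himg : ∀ i, MeasurableSet ((⇑C.T)^[i] '' c) :=
    fun i => (C.iter_emb i).measurableSet_image.2 hcm
  have h1 : (μ.prod μ) (C.W A n) ≤ ∑ i ∈ Finset.range (C.h j + 1),
      (μ.prod μ) (C.W A n ∩ C.Lv j i ×ˢ Set.univ) + μ (C.tw j)ᶜ := by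
    calc (μ.prod μ) (C.W A n) ≤ (μ.prod μ) ((⋃ i ∈ Finset.range (C.h j + 1),
          C.W A n ∩ C.Lv j i ×ˢ Set.univ) ∪ (C.tw j)ᶜ ×ˢ Set.univ) := by
          refine measure_mono fun x hx => ?_
          by_cases h : x.1 ∈ C.tw j
          · left
            simp only [tw, Set.mem_iUnion] at h ⊢
            obtain ⟨i, hi, hxi⟩ := h
            exact ⟨i, hi, hx, hxi, trivial⟩
          · exact Or.inr ⟨h, trivial⟩
      _ ≤ _ := by
          refine (measure_union_le _ _).trans
            (add_le_add (measure_biUnion_finset_le _ _) ?_)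
          rw [Measure.prod_prod, measure_univ, mul_one]
  refine h1.trans (add_le_add ?_ le_rfl)
  have h2 : ∀ i, (μ.prod μ) (C.W A n ∩ C.Lv j i ×ˢ Set.univ) ≤
      3 * (μ.prod μ) (C.W A n ∩ ((⇑C.T)^[i] '' c) ×ˢ Set.univ) := by
    intro i
    rw [Lv, C.rho_img hWm hWi (C.measE j), C.rho_img hWm hWi hcm]
    exact h3
  refine (Finset.sum_le_sum fun i _ => h2 i).trans ?_
  rw [← Finset.mul_sum]
  gcongr
  have hmm : ∀ i, MeasurableSet (C.W A n ∩ ((⇑C.T)^[i] '' c) ×ˢ (Set.univ : Set X)) :=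
    fun i => hWm.inter ((himg i).prod MeasurableSet.univ)
  rw [Finset.sum_congr rfl fun i _ => Measure.prod_apply_symm (hmm i),
    ← lintegral_finsetSum _ fun i _ => measurable_measure_prodMk_right (hmm i),
    ← lintegral_const_mul' _ _ (by norm_num)]
  refine lintegral_mono fun y => ?_
  refine le_trans (le_of_eq ?_) (C.sum_shift_le hc hn)
  refine Finset.sum_congr rfl fun i _ => ?_
  congr 1
  ext x
  simp [W, Set.mem_symmDiff]

lemma int_tendsto [IsProbabilityMeasure μ] (C : ChaconMap μ s) {A : Set (X × X)}
    (hA : MeasurableSet A) :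
    Tendsto (fun j => 3 * (2 * ∫⁻ y, C.V j ((fun x => (x, y)) ⁻¹' A) ∂μ) + μ (C.tw j)ᶜ)
      atTop (𝓝 0) := by
  have hs : ∀ y, MeasurableSet ((fun x : X => (x, y)) ⁻¹' A) := fun y => measurable_prodMk_right hA
  have h : Tendsto (fun j => ∫⁻ y, C.V j ((fun x => (x, y)) ⁻¹' A) ∂μ) atTop
      (𝓝 (∫⁻ _ : X, 0 ∂μ)) := by
    refine tendsto_lintegral_filter_of_dominated_convergence (fun _ => 1) ?_ ?_ ?_ ?_
    · refine Filter.Eventually.of_forall fun j => ?_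
      refine Finset.measurable_fun_sum _ fun i _ => Measurable.min ?_ ?_
      · have hp : MeasurableSet (C.Lv j i ×ˢ (Set.univ : Set X)) :=
          (C.measLv j i).prod MeasurableSet.univ
        convert measurable_measure_prodMk_right (μ := μ) (hp.inter hA) using 3 with y
        ext x
        simp
      · have hp : MeasurableSet (C.Lv j i ×ˢ (Set.univ : Set X)) :=
          (C.measLv j i).prod MeasurableSet.univ
        convert measurable_measure_prodMk_right (μ := μ) (hp.diff hA) using 3 with y
        ext x
        simp
    · filter_upwards [eventually_ge_atTop 1] with j hj
      exact Filter.Eventually.of_forall fun y => C.V_le_one hj (hs y)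
    · simp
    · exact Filter.Eventually.of_forall fun y => C.V_tendsto (hs y)
  rw [lintegral_zero] at h
  have h2 := ENNReal.Tendsto.const_mul (a := 3) (ENNReal.Tendsto.const_mul (a := 2) h
    (Or.inr (by norm_num))) (Or.inr (by norm_num))
  have h3 := h2.add C.tw_tendsto
  simpa using h3

lemma rho_congr [IsProbabilityMeasure μ] (W : Set (X × X)) {c c' : Set X} (h : c =ᵐ[μ] c') :
    (μ.prod μ) (W ∩ c ×ˢ Set.univ) = (μ.prod μ) (W ∩ c' ×ˢ Set.univ) :=
  measure_congr ((ae_eq_refl _).inter (Measure.set_prod_ae_eq h (ae_eq_refl _)))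

lemma W_bounds [IsProbabilityMeasure μ] (C : ChaconMap μ s) {A : Set (X × X)}
    (hA : MeasurableSet A) (hinv : (fun x : X × X => (C.T x.1, C.T x.2)) ⁻¹' A = A)
    {j : ℕ} (hj : 1 ≤ j) :
    (μ.prod μ) (C.W A (C.h j + 1)) ≤
      3 * (2 * ∫⁻ y, C.V j ((fun x => (x, y)) ⁻¹' A) ∂μ) + μ (C.tw j)ᶜ ∧
    (μ.prod μ) (C.W A (C.h j + 1 + s j)) ≤
      3 * (2 * ∫⁻ y, C.V j ((fun x => (x, y)) ⁻¹' A) ∂μ) + μ (C.tw j)ᶜ := by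
  have s1 := measure_symmDiff_eq_zero_iff.1 (C.stack1 j hj)
  have s2 := measure_symmDiff_eq_zero_iff.1 (C.stack2 j hj)
  have e12 : ∀ n, (μ.prod μ) (C.W A n ∩ C.E2 j ×ˢ Set.univ) =
      (μ.prod μ) (C.W A n ∩ C.E1 j ×ˢ Set.univ) := fun n => by
    rw [← rho_congr _ s1, C.rho_img (C.meas_W hA n) (C.W_inv hinv n) (C.measE1 j)]
  have e23 : ∀ n, (μ.prod μ) (C.W A n ∩ C.E3 j ×ˢ Set.univ) =
      (μ.prod μ) (C.W A n ∩ C.E2 j ×ˢ Set.univ) := fun n => by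
    rw [← rho_congr _ s2, C.rho_img (C.meas_W hA n) (C.W_inv hinv n) (C.measE2 j)]
  have e3 : ∀ n, (μ.prod μ) (C.W A n ∩ C.E j ×ˢ Set.univ) ≤
      3 * (μ.prod μ) (C.W A n ∩ C.E2 j ×ˢ Set.univ) := fun n => by
    rw [C.E_union j hj, Set.union_prod, Set.union_prod, Set.inter_union_distrib_left,
      Set.inter_union_distrib_left]
    refine (measure_union_le _ _).trans ((add_le_add (measure_union_le _ _) le_rfl).trans ?_)
    rw [e23, ← e12]
    apply le_of_eq
    ring
  constructor
  · refine C.W_bound hA hinv (C.measE1 j) (C.E1_sub hj) ?_ ((e3 _).trans (by rw [e12]))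
    exact s1.le.trans (Filter.Eventually.of_forall (C.E2_sub hj))
  · refine C.W_bound hA hinv (C.measE2 j) (C.E2_sub hj) ?_ (e3 _)
    exact s2.le.trans (Filter.Eventually.of_forall (C.E3_sub hj))

/-- triangle inequality for shifts -/
lemma W_tri [IsProbabilityMeasure μ] (C : ChaconMap μ s) {A : Set (X × X)}
    (hA : MeasurableSet A) (a b : ℕ) :
    (μ.prod μ) (C.W A b) ≤ (μ.prod μ) (C.W A a) + (μ.prod μ) (C.W A (a + b)) := by
  rw [← (C.mp_left a).measure_preimage (C.meas_W hA b).nullMeasurableSet]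
  refine (measure_mono ?_).trans (measure_union_le _ _)
  rintro ⟨x, y⟩
  simp only [W, Set.mem_preimage, Set.mem_union, Set.mem_symmDiff, ← Function.iterate_add_apply,
    add_comm b a]
  tauto

end ChaconMap

/-- the root Chacon map is weakly mixing: `T × T` is ergodic for
`μ ⊗ μ`. -/
theorem rootChacon_weaklyMixing
    {X : Type*} [MeasurableSpace X] (μ : Measure X) [IsProbabilityMeasure μ]
    (C : ChaconMap μ (fun j => Nat.sqrt j)) :
    Ergodic (fun x : X × X => (C.T x.1, C.T x.2)) (μ.prod μ) := by
  refine ⟨C.mp_prod, ⟨fun A hA hinv => ?_⟩⟩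
  have hlim := C.int_tendsto hA
  -- shift by `s j` is asymptotically trivial
  have hsj : Tendsto (fun j => (μ.prod μ) (C.W A (Nat.sqrt j))) atTop (𝓝 0) := by
    have h2 := hlim.add hlim
    rw [add_zero] at h2
    refine tendsto_of_tendsto_of_tendsto_of_le_of_le' tendsto_const_nhds h2
      (Filter.Eventually.of_forall fun _ => bot_le) ?_
    filter_upwards [eventually_ge_atTop 1] with j hj
    have hb := C.W_bounds hA hinv hj
    exact (C.W_tri hA (C.h j + 1) (Nat.sqrt j)).trans (add_le_add hb.1 hb.2)
  have hq : Tendsto (fun q => (μ.prod μ) (C.W A q)) atTop (𝓝 0) := by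
    have hsq : Tendsto (fun q : ℕ => q * q) atTop atTop :=
      tendsto_atTop_mono (fun q => Nat.le_mul_self q) tendsto_id
    have := hsj.comp hsq
    simpa [Function.comp_def, Nat.sqrt_eq] using this
  have hW1 : (μ.prod μ) (C.W A 1) = 0 := by
    have h := hq.add (hq.comp (tendsto_add_atTop_nat 1))
    rw [add_zero] at h
    exact le_antisymm (ge_of_tendsto' h fun q => C.W_tri hA q 1) bot_le
  -- sections
  have hsec : ∀ y, MeasurableSet ((fun x : X => (x, y)) ⁻¹' A) := fun y =>
    measurable_prodMk_right hA
  have h01 : ∀ᵐ y ∂μ, μ ((fun x : X => (x, y)) ⁻¹' A) = 0 ∨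
      μ ((fun x : X => (x, y)) ⁻¹' A)ᶜ = 0 := by
    rw [Measure.prod_apply_symm (C.meas_W hA 1),
      lintegral_eq_zero_iff (measurable_measure_prodMk_right (C.meas_W hA 1))] at hW1
    filter_upwards [hW1] with y hy
    refine C.ergodic_T (hsec y) ?_
    refine (measure_symmDiff_eq_zero_iff.1 ?_).symm
    exact hy
  have hmeas : Measurable fun y => μ ((fun x : X => (x, y)) ⁻¹' A) :=
    measurable_measure_prodMk_right hA
  have hB : MeasurableSet {y | μ ((fun x : X => (x, y)) ⁻¹' A) = 0} :=
    hmeas (measurableSet_singleton 0)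
  have hBinv : C.T ⁻¹' {y | μ ((fun x : X => (x, y)) ⁻¹' A) = 0} =
      {y | μ ((fun x : X => (x, y)) ⁻¹' A) = 0} := by
    ext y
    simp only [Set.mem_preimage, Set.mem_ofPred_eq]
    rw [← C.measurePreserving.measure_preimage (hsec (C.T y)).nullMeasurableSet]
    have : C.T ⁻¹' ((fun x : X => (x, C.T y)) ⁻¹' A) = (fun x : X => (x, y)) ⁻¹' A := by
      conv_rhs => rw [← hinv]
      rfl
    rw [this]
  rw [eventuallyConst_set']
  rcases C.ergodic_T hB hBinv.eventuallyEq with h | h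
  · right
    have : (μ.prod μ) Aᶜ = 0 := by
      rw [Measure.prod_apply_symm hA.compl, lintegral_eq_zero_iff
        (measurable_measure_prodMk_right hA.compl)]
      filter_upwards [h01, measure_eq_zero_iff_ae_notMem.1 h] with y hy hy'
      exact hy.resolve_left hy'
    exact ae_eq_univ.2 this
  · left
    have : (μ.prod μ) A = 0 := by
      rw [Measure.prod_apply_symm hA, lintegral_eq_zero_iff
        (measurable_measure_prodMk_right hA)]
      filter_upwards [measure_eq_zero_iff_ae_notMem.1 h] with y hy'
      exact not_not.1 hy'
    exact ae_eq_empty.2 this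
end
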